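/- Let 𝒟 be a testing context. (1) The equivalences =◇^𝒟 and =□^𝒟 are preserved by parallel composition with any ν ∈ 𝒟, by localization (L)·, and by convex combination: if I is finite, p_i ∈ [0,1] with Σ_{i∈I} p_i = 1, and μ_{1,i} =◇^𝒟 μ_{2,i} for all i, then Σ_i p_i μ_{1,i} =◇^𝒟 Σ_i p_i μ_{2,i} (likewise for =□^𝒟). (2) For 𝒟 = D(P_RCCS), the relation on P_RCCS given by P ≡ Q iff δ_P =◇^p δ_Q is a congruence for RCCS: it is preserved by nondeterministic choice (if P_{1,i} ≡ P_{2,i} for all i then Σ_i α_i.P_{1,i} ≡ Σ_i α_i.P_{2,i}), by probabilistic choice ⊕, by parallel composition, by localization, and by the fixpoint operator (for terms S, T with free variables among X1,…,Xn, if S[P̃] ≡ T[P̃] for all tuples P̃ of processes then μX1.S[P̃] ≡ μX1.T[P̃] for all P̃); the same holds with =□^p in place of =◇^p. -/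

import Mathlib

open scoped Classical

/-! ## Channels, actions, RCCS terms -/

/-- Channels, drawn from an infinite set. -/
abbrev Chan := ℕ

/-- Actions: input/output labels over channels, the silent action `τ`, and the
distinguished success action `ω` (used only by observers). -/
inductive Act where
  | inp : Chan → Act
  | out : Chan → Act
  | tau : Act
  | omega : Act
deriving DecidableEq

/-- `α` is an external label, i.e. a member of `𝓛 = N ∪ N̄`. -/
def Act.IsLabel : Act → Prop
  | .inp _ => True
  | .out _ => True
  | _ => False

/-- Complementary labels (for communication). -/
def Act.Comp : Act → Act → Prop := fun x y =>
  ∃ a, (x = .inp a ∧ y = .out a) ∨ (x = .out a ∧ y = .inp a)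

/-- `β, β̄ ∉ L`: the action is not blocked by the localization `(L)-`. -/
def Act.Allowed (L : Finset Chan) : Act → Prop
  | .inp a => a ∉ L
  | .out a => a ∉ L
  | _ => True

/-- Channels occurring in an action. -/
def Act.chans : Act → Finset Chan
  | .inp a => {a}
  | .out a => {a}
  | _ => ∅

/-- RCCS (and RCCS^ω) terms, with de Bruijn indices for process variables.
`sum k acts conts` is the nondeterministic choice `Σ_{i∈I} α_i.T_i` over the
nonempty finite index set `I = Fin (k+1)`, and `oplus k w conts` is the
probabilistic choice `⊕_{i∈I} p_i τ.T_i`. `fix T` is `μX.T` (binding index 0). -/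
inductive Tm where
  | nil : Tm
  | var : ℕ → Tm
  | sum : (k : ℕ) → (Fin (k+1) → Act) → (Fin (k+1) → Tm) → Tm
  | oplus : (k : ℕ) → (Fin (k+1) → ℝ) → (Fin (k+1) → Tm) → Tm
  | par : Tm → Tm → Tm
  | loc : Finset Chan → Tm → Tm
  | fix : Tm → Tm

/-- Substitution `T{P/X}` of a (closed) term `P` for the de Bruijn variable `n`. -/
def Tm.subst (P : Tm) : ℕ → Tm → Tm
  | _, .nil => .nil
  | n, .var m => if m = n then P else .var m
  | n, .sum k a c => .sum k a (fun i => Tm.subst P n (c i))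
  | n, .oplus k w c => .oplus k w (fun i => Tm.subst P n (c i))
  | n, .par S T => .par (Tm.subst P n S) (Tm.subst P n T)
  | n, .loc L T => .loc L (Tm.subst P n T)
  | n, .fix T => .fix (Tm.subst P (n+1) T)

/-- `T` has all its free variables among the first `n` de Bruijn indices.
`ClosedAt 0 T` means `T` is closed; `ClosedAt 1 T` means at most one free variable. -/
def Tm.ClosedAt : ℕ → Tm → Prop
  | _, .nil => True
  | n, .var m => m < n
  | n, .sum _ _ c => ∀ i, Tm.ClosedAt n (c i)
  | n, .oplus _ _ c => ∀ i, Tm.ClosedAt n (c i)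
  | n, .par S T => Tm.ClosedAt n S ∧ Tm.ClosedAt n T
  | n, .loc _ T => Tm.ClosedAt n T
  | n, .fix T => Tm.ClosedAt (n+1) T

/-- The success action `ω` does not occur in `T` (so `T` is a genuine RCCS term). -/
def Tm.NoOmega : Tm → Prop
  | .nil => True
  | .var _ => True
  | .sum _ a c => (∀ i, a i ≠ Act.omega) ∧ (∀ i, Tm.NoOmega (c i))
  | .oplus _ _ c => ∀ i, Tm.NoOmega (c i)
  | .par S T => Tm.NoOmega S ∧ Tm.NoOmega T
  | .loc _ T => Tm.NoOmega T
  | .fix T => Tm.NoOmega T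

/-- No probabilistic choice occurs in `T` (so `T` is a CCS term). -/
def Tm.NoOplus : Tm → Prop
  | .nil => True
  | .var _ => True
  | .sum _ _ c => ∀ i, Tm.NoOplus (c i)
  | .oplus _ _ _ => False
  | .par S T => Tm.NoOplus S ∧ Tm.NoOplus T
  | .loc _ T => Tm.NoOplus T
  | .fix T => Tm.NoOplus T

/-- The channels `N(T)` occurring in a term. -/
def Tm.chans : Tm → Finset Chan
  | .nil => ∅
  | .var _ => ∅
  | .sum _ a c =>
      (Finset.univ.sup fun i => (a i).chans) ∪ (Finset.univ.sup fun i => Tm.chans (c i))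
  | .oplus _ _ c => Finset.univ.sup fun i => Tm.chans (c i)
  | .par S T => S.chans ∪ T.chans
  | .loc L T => L ∪ T.chans
  | .fix T => T.chans

/-- Renaming of channels in an action. -/
def Act.rename (f : Chan → Chan) : Act → Act
  | .inp a => .inp (f a)
  | .out a => .out (f a)
  | x => x

/-- Renaming `T[f]` of the global channels of a term (local channels are untouched). -/
def Tm.rename : (Chan → Chan) → Tm → Tm
  | _, .nil => .nil
  | _, .var m => .var m
  | f, .sum k a c => .sum k (fun i => (a i).rename f) (fun i => Tm.rename f (c i))
  | f, .oplus k w c => .oplus k w (fun i => Tm.rename f (c i))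
  | f, .par S T => .par (Tm.rename f S) (Tm.rename f T)
  | f, .loc L T => .loc L (Tm.rename (fun a => if a ∈ L then a else f a) T)
  | f, .fix T => .fix (Tm.rename f T)

/-- `P` is an RCCS process: closed and without the success action. -/
def Tm.IsProc (P : Tm) : Prop := Tm.ClosedAt 0 P ∧ Tm.NoOmega P

/-- `P` is a CCS process: a process without probabilistic choice. -/
def Tm.IsCCS (P : Tm) : Prop := P.IsProc ∧ Tm.NoOplus P

/-! ## Finitely supported distributions -/

/-- Finitely supported probability distributions on `α`. -/
structure FinDist (α : Type) where
  toFun : α → ℝ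
  nonneg : ∀ a, 0 ≤ toFun a
  finite_support : (Function.support toFun).Finite
  sum_one : ∑ᶠ a, toFun a = 1

namespace FinDist

/-- The probability `μ(φ)` that a predicate (set) `φ` holds under `μ`. -/
noncomputable def mass {α : Type} (μ : FinDist α) (φ : Set α) : ℝ :=
  ∑ᶠ a ∈ φ, μ.toFun a

/-- The Dirac distribution `δ_P`. -/
noncomputable def dirac {α : Type} (P : α) : FinDist α where
  toFun := fun Q => if Q = P then 1 else 0
  nonneg := by intro a; by_cases h : a = P <;> simp [h]
  finite_support := by
    apply Set.Finite.subset (Set.finite_singleton P)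
    intro a ha
    by_contra h
    simp only [Set.mem_singleton_iff] at h
    simp [Function.mem_support, h] at ha
  sum_one := by
    rw [finsum_eq_single _ P (fun b hb => by simp [hb])]
    simp

/-- Pushforward of a finitely supported distribution along a map. -/
noncomputable def map {α β : Type} (g : α → β) (μ : FinDist α) : FinDist β where
  toFun := fun b => ∑ᶠ a ∈ {a | g a = b}, μ.toFun a
  nonneg := by
    intro b
    exact finsum_nonneg fun a => finsum_nonneg fun _ => μ.nonneg a
  finite_support := by
    apply Set.Finite.subset (μ.finite_support.image g)
    intro b hb
    rw [Function.mem_support] at hb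
    by_contra h
    apply hb
    apply finsum_mem_eq_zero_of_forall_eq_zero
    intro a ha
    by_contra ha0
    exact h ⟨a, Function.mem_support.mpr ha0, ha⟩
  sum_one := by
    classical
    set s := μ.finite_support.toFinset with hs
    have hfib : ∀ b : β, (∑ᶠ a ∈ {a | g a = b}, μ.toFun a)
        = ∑ a ∈ s.filter (fun a => g a = b), μ.toFun a := by
      intro b
      apply finsum_mem_eq_sum_of_inter_support_eq
      ext a
      simp only [Set.mem_inter_iff, Set.mem_setOf_eq, Finset.coe_filter,
        Set.Finite.mem_toFinset, Function.mem_support, hs]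
      tauto
    have hsub : Function.support (fun b : β => ∑ᶠ a ∈ {a | g a = b}, μ.toFun a) ⊆
        ↑(s.image g) := by
      intro b hb
      rw [Function.mem_support, hfib] at hb
      obtain ⟨a, ha, hne⟩ := Finset.exists_ne_zero_of_sum_ne_zero hb
      rw [Finset.mem_filter] at ha
      simp only [Finset.coe_image, Set.mem_image, Finset.mem_coe]
      exact ⟨a, ha.1, ha.2⟩
    rw [finsum_eq_finset_sum_of_support_subset _ hsub]
    calc ∑ b ∈ s.image g, ∑ᶠ a ∈ {a | g a = b}, μ.toFun a
        = ∑ b ∈ s.image g, ∑ a ∈ s.filter (fun a => g a = b), μ.toFun a :=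
          Finset.sum_congr rfl fun b _ => hfib b
      _ = ∑ a ∈ s, μ.toFun a :=
          Finset.sum_fiberwise_of_maps_to (fun a ha => Finset.mem_image_of_mem g ha)
            μ.toFun
      _ = 1 := by rw [← finsum_eq_sum μ.toFun μ.finite_support]; exact μ.sum_one

/-- The product of two finitely supported distributions. -/
noncomputable def prod {α β : Type} (μ : FinDist α) (ν : FinDist β) :
    FinDist (α × β) where
  toFun := fun x => μ.toFun x.1 * ν.toFun x.2
  nonneg := fun x => mul_nonneg (μ.nonneg _) (ν.nonneg _)
  finite_support := by
    apply Set.Finite.subset (μ.finite_support.prod ν.finite_support)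
    intro x hx
    rw [Function.mem_support] at hx
    have h := mul_ne_zero_iff.mp hx
    exact ⟨Function.mem_support.mpr h.1, Function.mem_support.mpr h.2⟩
  sum_one := by
    classical
    have hsub : Function.support (fun x : α × β => μ.toFun x.1 * ν.toFun x.2) ⊆
        ↑(μ.finite_support.toFinset ×ˢ ν.finite_support.toFinset) := by
      intro x hx
      rw [Function.mem_support] at hx
      have h := mul_ne_zero_iff.mp hx
      simp only [Finset.coe_product, Set.mem_prod, Set.Finite.coe_toFinset]
      exact ⟨h.1, h.2⟩
    rw [finsum_eq_finset_sum_of_support_subset _ hsub, Finset.sum_product]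
    have h1 : ∑ a ∈ μ.finite_support.toFinset, μ.toFun a = 1 := by
      rw [← finsum_eq_sum μ.toFun μ.finite_support]; exact μ.sum_one
    have h2 : ∑ b ∈ ν.finite_support.toFinset, ν.toFun b = 1 := by
      rw [← finsum_eq_sum ν.toFun ν.finite_support]; exact ν.sum_one
    calc ∑ a ∈ μ.finite_support.toFinset, ∑ b ∈ ν.finite_support.toFinset,
          μ.toFun a * ν.toFun b
        = ∑ a ∈ μ.finite_support.toFinset, μ.toFun a * 1 := by
          refine Finset.sum_congr rfl fun a _ => ?_
          rw [← Finset.mul_sum, h2]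
      _ = 1 := by simpa using h1

/-- Parallel composition `μ | ν` of distributions:
`(μ|ν)(A|B) = μ(A)·ν(B)`. -/
noncomputable def parD (μ ν : FinDist Tm) : FinDist Tm :=
  (μ.prod ν).map fun x => Tm.par x.1 x.2

/-- Localization `(L)μ` of a distribution. -/
noncomputable def locD (L : Finset Chan) (μ : FinDist Tm) : FinDist Tm :=
  μ.map (Tm.loc L)

/-- Renaming `μ[f]` of a distribution. -/
noncomputable def renameD (f : Chan → Chan) (μ : FinDist Tm) : FinDist Tm :=
  μ.map (Tm.rename f)

/-- Instantiation `ϑ[P]` of a 1-ary distribution `ϑ` at the process `P`. -/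
noncomputable def instD (ϑ : FinDist Tm) (P : Tm) : FinDist Tm :=
  ϑ.map (fun T => Tm.subst P 0 T)

/-- Every element of the support is a process (`μ ∈ D(P_RCCS)`). -/
def IsProcDist (μ : FinDist Tm) : Prop := ∀ P, μ.toFun P ≠ 0 → P.IsProc

/-- All channels occurring in (the support of) `μ` lie in `L`. -/
def chansIn (μ : FinDist Tm) (L : Finset Chan) : Prop :=
  ∀ P, μ.toFun P ≠ 0 → P.chans ⊆ L

/-- The channel `a` occurs in (the support of) `μ`, i.e. `a ∈ N(μ)`. -/
def hasChan (μ : FinDist Tm) (a : Chan) : Prop := ∃ P, μ.toFun P ≠ 0 ∧ a ∈ P.chans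

end FinDist

/-! ## Part I: the probabilistic labelled transition system on processes -/

/-- Part I of the pLTS for RCCS (and RCCS^ω): `P →α ρ`. -/
inductive Step : Tm → Act → FinDist Tm → Prop where
  | choice {k : ℕ} (acts : Fin (k+1) → Act) (conts : Fin (k+1) → Tm) (i : Fin (k+1)) :
      Step (.sum k acts conts) (acts i) (FinDist.dirac (conts i))
  | oplus {k : ℕ} (w : Fin (k+1) → ℝ) (conts : Fin (k+1) → Tm) (ρ : FinDist Tm) :
      (∀ i, 0 < w i ∧ w i < 1) →
      (∀ Q, ρ.toFun Q = ∑ i, if conts i = Q then w i else 0) →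
      Step (.oplus k w conts) .tau ρ
  | parL {S : Tm} {α : Act} {ρ : FinDist Tm} (T : Tm) :
      Step S α ρ → Step (.par S T) α (ρ.parD (FinDist.dirac T))
  | parR {T : Tm} {α : Act} {ρ : FinDist Tm} (S : Tm) :
      Step T α ρ → Step (.par S T) α ((FinDist.dirac S).parD ρ)
  | comm {S T : Tm} {ℓ1 ℓ2 : Act} {ρ1 ρ2 : FinDist Tm} :
      Act.Comp ℓ1 ℓ2 → Step S ℓ1 ρ1 → Step T ℓ2 ρ2 →
      Step (.par S T) .tau (ρ1.parD ρ2)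
  | loc {T : Tm} {β : Act} {ρ : FinDist Tm} (L : Finset Chan) :
      Step T β ρ → Act.Allowed L β → Step (.loc L T) β (FinDist.locD L ρ)
  | fixp {T : Tm} {β : Act} {ρ : FinDist Tm} :
      Step (Tm.subst (.fix T) 0 T) β ρ → Step (.fix T) β ρ

/-! ## Part II: probabilistic transitions on distributions -/

/-- Part II of the pLTS: `μ →(α,p) ν` iff `0 < p ≤ 1` and there are `P ∈ supp μ`
and `ρ` with `P →α ρ` and `ν = μ + μ(P)·p·(ρ − δ_P)`. -/
def PStep (μ : FinDist Tm) (α : Act) (p : ℝ) (ν : FinDist Tm) : Prop :=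
  0 < p ∧ p ≤ 1 ∧
    ∃ P ρ, 0 < μ.toFun P ∧ Step P α ρ ∧
      ∀ Q, ν.toFun Q = μ.toFun Q + μ.toFun P * p * (ρ.toFun Q - (if Q = P then 1 else 0))

/-- Probabilistic transition sequence `μ →π ν` along a word `π`. -/
def PSeq : FinDist Tm → List (Act × ℝ) → FinDist Tm → Prop
  | μ, [], ν => ν = μ
  | μ, s :: π, ν => ∃ μ', PStep μ s.1 s.2 μ' ∧ PSeq μ' π ν

/-- Internal transition sequence `μ ⇝ ν`. -/
def Internal (μ ν : FinDist Tm) : Prop :=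
  ∃ π : List (Act × ℝ), (∀ s ∈ π, s.1 = Act.tau) ∧ PSeq μ π ν

/-! ## Observability predicates and testing characteristics -/

/-- `ψ_𝓛`: processes that can immediately perform an external action. -/
def psiL : Set Tm := {P | ∃ α ρ, Act.IsLabel α ∧ Step P α ρ}

/-- `ψ_ω`: processes that can immediately perform the success action `ω`. -/
def psiOmega : Set Tm := {P | ∃ ρ, Step P Act.omega ρ}

/-- The may characteristic `χmay_𝓛(μ) = sup { ν(ψ_𝓛) : μ ⇝ ν }`. -/
noncomputable def chiMayL (μ : FinDist Tm) : ℝ :=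
  sSup {x | ∃ ν, Internal μ ν ∧ x = ν.mass psiL}

/-- The fair characteristic `χfair_𝓛(μ) = inf { χmay_𝓛(ν) : μ ⇝ ν }`. -/
noncomputable def chiFairL (μ : FinDist Tm) : ℝ :=
  sInf {x | ∃ ν, Internal μ ν ∧ x = chiMayL ν}

/-- `χmay_ω(μ) = sup { ν(ψ_ω) : μ ⇝ ν }`. -/
noncomputable def chiMayOmega (μ : FinDist Tm) : ℝ :=
  sSup {x | ∃ ν, Internal μ ν ∧ x = ν.mass psiOmega}

/-- `χfair_ω(μ) = inf { χmay_ω(ν) : μ ⇝ ν }`. -/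
noncomputable def chiFairOmega (μ : FinDist Tm) : ℝ :=
  sInf {x | ∃ ν, Internal μ ν ∧ x = chiMayOmega ν}

/-! ## Testing contexts, equipollence, extensionality, diamond/box equivalences -/

/-- `Δ(P_CCS) ⊆ 𝒟 ⊆ D(P_RCCS)`, closed under parallel composition, localization
and (finite-domain) renaming. -/
structure IsTestingContext (D : Set (FinDist Tm)) : Prop where
  dirac_ccs : ∀ P : Tm, P.IsCCS → FinDist.dirac P ∈ D
  proc_dist : ∀ μ ∈ D, μ.IsProcDist
  closed_par : ∀ μ ∈ D, ∀ ν ∈ D, μ.parD ν ∈ D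
  closed_loc : ∀ μ ∈ D, ∀ L : Finset Chan, FinDist.locD L μ ∈ D
  closed_rename : ∀ μ ∈ D, ∀ f : Chan → Chan, {a | f a ≠ a}.Finite →
      FinDist.renameD f μ ∈ D

/-- `R` is probabilistically equipollent. -/
def Equipollent (R : FinDist Tm → FinDist Tm → Prop) : Prop :=
  ∀ μ1 μ2, R μ1 μ2 → chiMayL μ1 = chiMayL μ2

/-- `R` is probabilistically strongly equipollent. -/
def StronglyEquipollent (R : FinDist Tm → FinDist Tm → Prop) : Prop :=
  ∀ μ1 μ2, R μ1 μ2 → chiFairL μ1 = chiFairL μ2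

/-- `R` is `𝒟`-extensional. -/
def DExtensional (D : Set (FinDist Tm)) (R : FinDist Tm → FinDist Tm → Prop) : Prop :=
  ∀ μ1 μ2, R μ1 μ2 →
    (∀ ν ∈ D, R (μ1.parD ν) (μ2.parD ν)) ∧
    (∀ L : Finset Chan, R (FinDist.locD L μ1) (FinDist.locD L μ2))

/-- The `𝒟`-diamond equivalence `=◇^𝒟`, the largest probabilistically equipollent
`𝒟`-extensional relation. -/
def DiamondEq (D : Set (FinDist Tm)) (μ1 μ2 : FinDist Tm) : Prop :=
  ∃ R, Equipollent R ∧ DExtensional D R ∧ R μ1 μ2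

/-- The `𝒟`-box equivalence `=□^𝒟`, the largest probabilistically strongly
equipollent `𝒟`-extensional relation. -/
def BoxEq (D : Set (FinDist Tm)) (μ1 μ2 : FinDist Tm) : Prop :=
  ∃ R, StronglyEquipollent R ∧ DExtensional D R ∧ R μ1 μ2

/-! ## Probabilistic strong bisimulation and lifting -/

/-- Lifting of a relation on processes to distributions, matching the decomposition
`ρ1 = Σ_i p_i δ_{A_i}`, `ρ2 = Σ_i p_i δ_{B_i}` with `A_i R B_i`. -/
def RelLift (R : Tm → Tm → Prop) (ρ1 ρ2 : FinDist Tm) : Prop :=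
  ∃ (k : ℕ) (p : Fin (k+1) → ℝ) (A B : Fin (k+1) → Tm),
    (∀ i, 0 ≤ p i) ∧
    (∀ Q, ρ1.toFun Q = ∑ i, if A i = Q then p i else 0) ∧
    (∀ Q, ρ2.toFun Q = ∑ i, if B i = Q then p i else 0) ∧
    (∀ i, R (A i) (B i))

/-- `R` is a probabilistic strong bisimulation. -/
def IsStrongBisim (R : Tm → Tm → Prop) : Prop :=
  ∀ P Q, R P Q →
    (∀ α ρ, Step P α ρ → ∃ ρ', Step Q α ρ' ∧ RelLift R ρ ρ') ∧
    (∀ α ρ, Step Q α ρ → ∃ ρ', Step P α ρ' ∧ RelLift R ρ ρ')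

/-- `∼p`, the largest probabilistic strong bisimulation. -/
def StrongBisim (P Q : Tm) : Prop := ∃ R, IsStrongBisim R ∧ R P Q

/-- Lifting `E†` of an equivalence on processes to distributions: agreement on the
mass of every equivalence class. -/
def EqLift (E : Tm → Tm → Prop) (μ1 μ2 : FinDist Tm) : Prop :=
  ∀ P, μ1.mass {Q | E P Q} = μ2.mass {Q | E P Q}

/-- Simultaneous substitution of the (closed) processes `σ 0, σ 1, …` for all free
de Bruijn variables, under `d` binders. -/
def Tm.msubst (σ : ℕ → Tm) : ℕ → Tm → Tm
  | _, .nil => .nil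
  | d, .var m => if m < d then .var m else σ (m - d)
  | d, .sum k a c => .sum k a (fun i => Tm.msubst σ d (c i))
  | d, .oplus k w c => .oplus k w (fun i => Tm.msubst σ d (c i))
  | d, .par S T => .par (Tm.msubst σ d S) (Tm.msubst σ d T)
  | d, .loc L T => .loc L (Tm.msubst σ d T)
  | d, .fix T => .fix (Tm.msubst σ (d+1) T)

/-- The probabilistic testing context `𝒟 = D(P_RCCS)` of all distributions over
processes. -/
def fullCtx : Set (FinDist Tm) := {μ | μ.IsProcDist}

/-! ## Expectations -/

namespace FinDist

theorem ext_fun {α : Type} {μ ν : FinDist α} (h : ∀ a, μ.toFun a = ν.toFun a) : μ = ν := by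
  cases μ; cases ν
  simp only [mk.injEq]
  exact funext h

/-- Expectation of a real function. -/
noncomputable def ev {α : Type} (μ : FinDist α) (h : α → ℝ) : ℝ := ∑ᶠ a, μ.toFun a * h a

/-- The support as a finset. -/
noncomputable def supp {α : Type} (μ : FinDist α) : Finset α := μ.finite_support.toFinset

theorem mem_supp {α : Type} (μ : FinDist α) (a : α) : a ∈ μ.supp ↔ μ.toFun a ≠ 0 := by
  simp [supp]

theorem ev_eq {α : Type} (μ : FinDist α) (h : α → ℝ) (s : Finset α) (hs : μ.supp ⊆ s) :
    μ.ev h = ∑ a ∈ s, μ.toFun a * h a := by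
  unfold ev
  apply finsum_eq_finset_sum_of_support_subset
  intro a ha
  apply hs
  rw [mem_supp]
  rw [Function.mem_support] at ha
  exact left_ne_zero_of_mul ha

theorem ev_supp {α : Type} (μ : FinDist α) (h : α → ℝ) :
    μ.ev h = ∑ a ∈ μ.supp, μ.toFun a * h a := ev_eq μ h _ subset_rfl

theorem sum_supp {α : Type} (μ : FinDist α) (s : Finset α) (hs : μ.supp ⊆ s) :
    ∑ a ∈ s, μ.toFun a = 1 := by
  have := ev_eq μ (fun _ => 1) s hs
  simp only [mul_one] at this
  rw [← this]
  unfold ev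
  simpa using μ.sum_one

theorem ev_const {α : Type} (μ : FinDist α) (c : ℝ) : μ.ev (fun _ => c) = c := by
  rw [ev_supp, ← Finset.sum_mul, sum_supp _ _ subset_rfl, one_mul]

theorem ev_mono {α : Type} (μ : FinDist α) {f g : α → ℝ}
    (h : ∀ a, μ.toFun a ≠ 0 → f a ≤ g a) : μ.ev f ≤ μ.ev g := by
  rw [ev_supp, ev_supp]
  apply Finset.sum_le_sum
  intro a ha
  exact mul_le_mul_of_nonneg_left (h a ((mem_supp _ _).1 ha)) (μ.nonneg a)

theorem ev_congr {α : Type} (μ : FinDist α) {f g : α → ℝ}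
    (h : ∀ a, μ.toFun a ≠ 0 → f a = g a) : μ.ev f = μ.ev g :=
  le_antisymm (ev_mono μ fun a ha => (h a ha).le) (ev_mono μ fun a ha => (h a ha).ge)

theorem ev_neg {α : Type} (μ : FinDist α) (f : α → ℝ) : μ.ev (fun a => - f a) = - μ.ev f := by
  rw [ev_supp, ev_supp, ← Finset.sum_neg_distrib]
  exact Finset.sum_congr rfl fun a _ => by ring

theorem ev_add {α : Type} (μ : FinDist α) (f g : α → ℝ) :
    μ.ev (fun a => f a + g a) = μ.ev f + μ.ev g := by
  rw [ev_supp, ev_supp, ev_supp, ← Finset.sum_add_distrib]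
  exact Finset.sum_congr rfl fun a _ => by ring

theorem ev_one_sub {α : Type} (μ : FinDist α) (f : α → ℝ) :
    μ.ev (fun a => 1 - f a) = 1 - μ.ev f := by
  have := ev_add μ (fun _ => 1) (fun a => - f a)
  rw [ev_const, ev_neg] at this
  simpa [sub_eq_add_neg] using this

theorem ev_le {α : Type} (μ : FinDist α) {f : α → ℝ} {c : ℝ}
    (h : ∀ a, μ.toFun a ≠ 0 → f a ≤ c) : μ.ev f ≤ c := by
  have := ev_mono μ (g := fun _ => c) h
  rwa [ev_const] at this

theorem le_ev {α : Type} (μ : FinDist α) {f : α → ℝ} {c : ℝ}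
    (h : ∀ a, μ.toFun a ≠ 0 → c ≤ f a) : c ≤ μ.ev f := by
  have := ev_mono μ (f := fun _ => c) h
  rwa [ev_const] at this

theorem ev_indicator {α : Type} (μ : FinDist α) (b : α) :
    μ.ev (fun a => if a = b then 1 else 0) = μ.toFun b := by
  unfold ev
  rw [finsum_eq_single _ b (fun a ha => by simp [ha])]
  simp

theorem ext_ev {α : Type} {μ ν : FinDist α} (h : ∀ f, μ.ev f = ν.ev f) : μ = ν := by
  apply ext_fun
  intro a
  rw [← ev_indicator, ← ev_indicator, h]

theorem ev_dirac {α : Type} (P : α) (h : α → ℝ) : (dirac P).ev h = h P := by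
  unfold ev
  rw [finsum_eq_single _ P (fun a ha => by simp [dirac, ha])]
  simp [dirac]

theorem dirac_ne {α : Type} {P Q : α} (h : (dirac P).toFun Q ≠ 0) : Q = P := by
  by_contra hn
  exact h (by simp [dirac, hn])

theorem ev_map {α β : Type} (g : α → β) (μ : FinDist α) (h : β → ℝ) :
    (μ.map g).ev h = μ.ev (fun a => h (g a)) := by
  have hfib : ∀ b : β, (μ.map g).toFun b
      = ∑ a ∈ μ.supp.filter (fun a => g a = b), μ.toFun a := by
    intro b
    apply finsum_mem_eq_sum_of_inter_support_eq
    ext a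
    simp only [Set.mem_inter_iff, Set.mem_setOf_eq, Finset.coe_filter,
      mem_supp, Function.mem_support]
    tauto
  have hsub : (μ.map g).supp ⊆ μ.supp.image g := by
    intro b hb
    rw [mem_supp, hfib] at hb
    obtain ⟨a, ha, hne⟩ := Finset.exists_ne_zero_of_sum_ne_zero hb
    rw [Finset.mem_filter] at ha
    exact Finset.mem_image.2 ⟨a, ha.1, ha.2⟩
  rw [ev_eq _ _ _ hsub, ev_supp,
    ← Finset.sum_fiberwise_of_maps_to (fun a ha => Finset.mem_image_of_mem g ha)]
  refine Finset.sum_congr rfl fun b _ => ?_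
  rw [hfib, Finset.sum_mul]
  refine Finset.sum_congr rfl fun a ha => ?_
  rw [(Finset.mem_filter.1 ha).2]

theorem map_ne {α β : Type} {g : α → β} {μ : FinDist α} {b : β}
    (h : (μ.map g).toFun b ≠ 0) : ∃ a, μ.toFun a ≠ 0 ∧ g a = b := by
  by_contra hn
  apply h
  apply finsum_mem_eq_zero_of_forall_eq_zero
  intro a ha
  by_contra h0
  exact hn ⟨a, h0, ha⟩

theorem ev_prod {α β : Type} (μ : FinDist α) (ν : FinDist β) (h : α × β → ℝ) :
    (μ.prod ν).ev h = μ.ev (fun a => ν.ev (fun b => h (a, b))) := by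
  have hsub : (μ.prod ν).supp ⊆ μ.supp ×ˢ ν.supp := by
    intro x hx
    rw [mem_supp] at hx
    have h := mul_ne_zero_iff.mp hx
    rw [Finset.mem_product, mem_supp, mem_supp]
    exact h
  rw [ev_eq _ _ _ hsub, Finset.sum_product, ev_supp]
  refine Finset.sum_congr rfl fun a _ => ?_
  rw [ev_supp, Finset.mul_sum]
  refine Finset.sum_congr rfl fun b _ => ?_
  simp only [prod]
  ring

theorem ev_swap {α β : Type} (μ : FinDist α) (ν : FinDist β) (h : α → β → ℝ) :
    μ.ev (fun a => ν.ev (fun b => h a b)) = ν.ev (fun b => μ.ev (fun a => h a b)) := by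
  simp only [ev_supp, Finset.mul_sum]
  rw [Finset.sum_comm]
  refine Finset.sum_congr rfl fun b _ => Finset.sum_congr rfl fun a _ => by ring

theorem ev_parD (μ ν : FinDist Tm) (h : Tm → ℝ) :
    (μ.parD ν).ev h = μ.ev (fun a => ν.ev (fun b => h (.par a b))) := by
  unfold parD
  rw [ev_map, ev_prod]

theorem ev_locD (L : Finset Chan) (μ : FinDist Tm) (h : Tm → ℝ) :
    (locD L μ).ev h = μ.ev (fun a => h (.loc L a)) := ev_map _ _ _

theorem parD_ne {μ ν : FinDist Tm} {Q : Tm} (h : (μ.parD ν).toFun Q ≠ 0) :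
    ∃ A B, μ.toFun A ≠ 0 ∧ ν.toFun B ≠ 0 ∧ Q = .par A B := by
  obtain ⟨x, hx, rfl⟩ := map_ne h
  have h := mul_ne_zero_iff.mp hx
  exact ⟨x.1, x.2, h.1, h.2, rfl⟩

theorem locD_ne {L : Finset Chan} {μ : FinDist Tm} {Q : Tm} (h : (locD L μ).toFun Q ≠ 0) :
    ∃ A, μ.toFun A ≠ 0 ∧ Q = .loc L A := by
  obtain ⟨x, hx, rfl⟩ := map_ne h
  exact ⟨x, hx, rfl⟩

theorem parD_dirac (P Q : Tm) : (dirac P).parD (dirac Q) = dirac (.par P Q) :=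
  ext_ev fun f => by rw [ev_parD, ev_dirac, ev_dirac, ev_dirac]

theorem locD_dirac (L : Finset Chan) (P : Tm) : locD L (dirac P) = dirac (.loc L P) :=
  ext_ev fun f => by rw [ev_locD, ev_dirac, ev_dirac]

theorem mass_eq (μ : FinDist Tm) (φ : Set Tm) :
    μ.mass φ = μ.ev (fun a => if a ∈ φ then 1 else 0) := by
  unfold mass ev
  apply finsum_congr
  intro a
  by_cases h : a ∈ φ <;> simp [h]

/-- Expectation of a finite linear combination. -/
theorem ev_lin {n : ℕ} (p : Fin n → ℝ) (μs : Fin n → FinDist Tm) (μ : FinDist Tm)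
    (h : ∀ Q, μ.toFun Q = ∑ i, p i * (μs i).toFun Q) (f : Tm → ℝ) :
    μ.ev f = ∑ i, p i * (μs i).ev f := by
  let s := μ.supp ∪ Finset.univ.biUnion fun i => (μs i).supp
  rw [ev_eq μ f s Finset.subset_union_left]
  have : ∀ i, (μs i).ev f = ∑ a ∈ s, (μs i).toFun a * f a := fun i =>
    ev_eq _ _ _ ((Finset.subset_biUnion_of_mem (fun i => (μs i).supp)
      (Finset.mem_univ i)).trans Finset.subset_union_right)
  simp only [this, Finset.mul_sum]
  rw [Finset.sum_comm]
  refine Finset.sum_congr rfl fun a _ => ?_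
  rw [h, Finset.sum_mul]
  exact Finset.sum_congr rfl fun i _ => by ring

theorem lin_of_ev {n : ℕ} (p : Fin n → ℝ) (μs : Fin n → FinDist Tm) (μ : FinDist Tm)
    (h : ∀ f : Tm → ℝ, μ.ev f = ∑ i, p i * (μs i).ev f) (Q : Tm) :
    μ.toFun Q = ∑ i, p i * (μs i).toFun Q := by
  simp only [← ev_indicator]
  exact h _

end FinDist

open FinDist

/-! ## Internal sequences -/

/-- One silent step. -/
def TS (μ ν : FinDist Tm) : Prop := ∃ p, PStep μ .tau p ν

theorem internal_iff (μ ν : FinDist Tm) : Internal μ ν ↔ Relation.ReflTransGen TS μ ν := by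
  constructor
  · rintro ⟨π, h1, h2⟩
    induction π generalizing μ with
    | nil => rw [PSeq] at h2; rw [h2]
    | cons s π ih =>
      obtain ⟨μ', h3, h4⟩ := h2
      have hs : s.1 = .tau := h1 s (by simp)
      rw [hs] at h3
      exact Relation.ReflTransGen.head ⟨s.2, h3⟩
        (ih μ' (fun t ht => h1 t (by simp [ht])) h4)
  · intro h
    induction h using Relation.ReflTransGen.head_induction_on with
    | refl => exact ⟨[], by simp, rfl⟩
    | head h1 _ ih =>
      obtain ⟨p, hp⟩ := h1
      obtain ⟨π, h3, h4⟩ := ih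
      refine ⟨(.tau, p) :: π, ?_, _, hp, h4⟩
      intro s hs
      rcases List.mem_cons.1 hs with rfl | hs
      · rfl
      · exact h3 s hs

theorem pstep_ev {μ ν ρ : FinDist Tm} {P : Tm} {c : ℝ}
    (h : ∀ Q, ν.toFun Q = μ.toFun Q + c * (ρ.toFun Q - (if Q = P then 1 else 0)))
    (f : Tm → ℝ) : ν.ev f = μ.ev f + c * (ρ.ev f - f P) := by
  let s := ν.supp ∪ (μ.supp ∪ (ρ.supp ∪ {P}))
  have e1 : ν.supp ⊆ s := fun x hx => by simp only [s, Finset.mem_union]; tauto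
  have e2 : μ.supp ⊆ s := fun x hx => by simp only [s, Finset.mem_union]; tauto
  have e3 : ρ.supp ⊆ s := fun x hx => by simp only [s, Finset.mem_union]; tauto
  have e4 : P ∈ s := by simp [s]
  rw [ev_eq _ _ s e1, ev_eq _ _ s e2, ev_eq _ _ s e3]
  have : f P = ∑ a ∈ s, (if a = P then 1 else 0) * f a := by
    simp [e4]
  rw [this, ← Finset.sum_sub_distrib, Finset.mul_sum, ← Finset.sum_add_distrib]
  refine Finset.sum_congr rfl fun a _ => ?_
  rw [h]
  ring

/-- Any super-harmonic function decreases along internal sequences. -/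
theorem ev_le_of_internal {f : Tm → ℝ} (hf : ∀ P ρ, Step P .tau ρ → ρ.ev f ≤ f P)
    {μ ν : FinDist Tm} (h : Internal μ ν) : ν.ev f ≤ μ.ev f := by
  rw [internal_iff] at h
  induction h with
  | refl => exact le_rfl
  | tail _ h ih =>
    obtain ⟨p, hp0, hp1, P, ρ, hP, hs, he⟩ := h
    rw [pstep_ev he f]
    have := hf P ρ hs
    have : 0 < _ * p := mul_pos hP hp0
    nlinarith

theorem internal_of_step {P : Tm} {ρ : FinDist Tm} (h : Step P .tau ρ) :
    Internal (dirac P) ρ := by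
  rw [internal_iff]
  apply Relation.ReflTransGen.single
  refine ⟨1, one_pos, le_rfl, P, ρ, by simp [dirac], h, ?_⟩
  intro Q
  simp [dirac]

theorem Internal.trans' {μ ν κ : FinDist Tm} (h1 : Internal μ ν) (h2 : Internal ν κ) :
    Internal μ κ := by
  rw [internal_iff] at *
  exact h1.trans h2

theorem Internal.refl' (μ : FinDist Tm) : Internal μ μ := by
  rw [internal_iff]

/-- Build a distribution `a ν1 + r` out of `μ = a μ1 + r`. -/
theorem exists_mix {μ μ1 ν1 : FinDist Tm} {a : ℝ} {r : Tm → ℝ} (ha : 0 ≤ a)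
    (hr : ∀ Q, 0 ≤ r Q) (hμ : ∀ Q, μ.toFun Q = a * μ1.toFun Q + r Q) :
    ∃ ν : FinDist Tm, ∀ Q, ν.toFun Q = a * ν1.toFun Q + r Q := by
  let s := ν1.supp ∪ (μ.supp ∪ μ1.supp)
  have e1 : ν1.supp ⊆ s := fun x hx => by simp only [s, Finset.mem_union]; tauto
  have e2 : μ.supp ⊆ s := fun x hx => by simp only [s, Finset.mem_union]; tauto
  have e3 : μ1.supp ⊆ s := fun x hx => by simp only [s, Finset.mem_union]; tauto
  have hsub : Function.support (fun Q => a * ν1.toFun Q + r Q) ⊆ s := by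
    intro Q hQ
    by_contra hn
    apply hQ
    have h1 : ν1.toFun Q = 0 := by
      by_contra h; exact hn (e1 ((mem_supp _ _).2 h))
    have h2 : μ.toFun Q = 0 := by
      by_contra h; exact hn (e2 ((mem_supp _ _).2 h))
    have h3 := hμ Q
    have h4 := mul_nonneg ha (μ1.nonneg Q)
    have h5 := hr Q
    simp only [h1, mul_zero, zero_add]
    linarith
  refine ⟨⟨fun Q => a * ν1.toFun Q + r Q, fun Q => add_nonneg (mul_nonneg ha (ν1.nonneg Q)) (hr Q),
    s.finite_toSet.subset hsub, ?_⟩, fun Q => rfl⟩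
  rw [finsum_eq_finset_sum_of_support_subset _ hsub]
  have : ∀ Q, a * ν1.toFun Q + r Q = μ.toFun Q + a * ν1.toFun Q - a * μ1.toFun Q := by
    intro Q; rw [hμ]; ring
  simp only [this, Finset.sum_sub_distrib, Finset.sum_add_distrib, ← Finset.mul_sum]
  rw [sum_supp _ _ e1, sum_supp _ _ e2, sum_supp _ _ e3]
  ring

theorem internal_frame {μ1 ν1 : FinDist Tm} (h : Internal μ1 ν1) {a : ℝ} (ha : 0 ≤ a)
    {r : Tm → ℝ} (hr : ∀ Q, 0 ≤ r Q) {μ : FinDist Tm}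
    (hμ : ∀ Q, μ.toFun Q = a * μ1.toFun Q + r Q) :
    ∃ ν, Internal μ ν ∧ ∀ Q, ν.toFun Q = a * ν1.toFun Q + r Q := by
  rw [internal_iff] at h
  induction h with
  | refl => exact ⟨μ, Internal.refl' μ, hμ⟩
  | @tail κ1 κ2 _ h ih =>
    obtain ⟨κ, h1, h2⟩ := ih
    rcases ha.eq_or_lt with rfl | ha'
    · exact ⟨κ, h1, fun Q => by rw [h2]; simp⟩
    obtain ⟨ν, hν⟩ := exists_mix (ν1 := κ2) ha hr h2
    refine ⟨ν, h1.trans' ?_, hν⟩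
    obtain ⟨p, hp0, hp1, P, ρ, hP, hs, he⟩ := h
    have hκ : 0 < κ.toFun P := by
      rw [h2]; have := mul_pos ha' hP; have := hr P; linarith
    rw [internal_iff]
    apply Relation.ReflTransGen.single
    refine ⟨a * κ1.toFun P * p / κ.toFun P, by positivity, ?_, P, ρ, hκ, hs, ?_⟩
    · rw [div_le_one hκ, h2]
      have := hr P
      have := mul_pos ha' hP
      nlinarith
    · intro Q
      rw [hν, he, mul_div_cancel₀ _ hκ.ne', h2 Q]
      ring

/-- Combining independent internal sequences from all points of the support. -/
theorem internal_bind (μ : FinDist Tm) (K : Tm → FinDist Tm)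
    (hK : ∀ P, Internal (dirac P) (K P)) :
    ∃ ν, Internal μ ν ∧ ∀ f, ν.ev f = μ.ev (fun P => (K P).ev f) := by
  have key : ∀ s : Finset Tm, ∃ ν, Internal μ ν ∧ ∀ Q, ν.toFun Q =
      (∑ P ∈ s, μ.toFun P * (K P).toFun Q) + (if Q ∈ s then 0 else μ.toFun Q) := by
    intro s
    induction s using Finset.induction_on with
    | empty => exact ⟨μ, Internal.refl' μ, by simp⟩
    | @insert P s hP ih =>
      obtain ⟨κ, h1, h2⟩ := ih
      obtain ⟨ν, h3, h4⟩ := internal_frame (hK P) (μ.nonneg P)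
        (r := fun Q => (∑ P ∈ s, μ.toFun P * (K P).toFun Q) +
          (if Q ∈ insert P s then 0 else μ.toFun Q)) (μ := κ) (by
          intro Q
          apply add_nonneg
          · exact Finset.sum_nonneg fun P _ => mul_nonneg (μ.nonneg P) ((K P).nonneg Q)
          · split_ifs
            · exact le_rfl
            · exact μ.nonneg Q) (by
          intro Q
          rw [h2]
          by_cases hQ : Q = P
          · subst hQ; simp [hP, dirac]; ring
          · simp [hQ, dirac])
      refine ⟨ν, h1.trans' h3, fun Q => ?_⟩
      rw [h4, Finset.sum_insert hP, add_assoc]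
  obtain ⟨ν, h1, h2⟩ := key μ.supp
  refine ⟨ν, h1, fun f => ?_⟩
  have h3 : ∀ Q, ν.toFun Q = ∑ P ∈ μ.supp, μ.toFun P * (K P).toFun Q := by
    intro Q
    rw [h2]
    by_cases hQ : Q ∈ μ.supp
    · simp [hQ]
    · have : μ.toFun Q = 0 := by
        by_contra h; exact hQ ((mem_supp _ _).2 h)
      simp [this]
  let t := ν.supp ∪ μ.supp.biUnion fun P => (K P).supp
  rw [ev_eq ν f t Finset.subset_union_left, ev_supp]
  have h4 : ∀ P ∈ μ.supp, μ.toFun P * (K P).ev f =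
      ∑ a ∈ t, μ.toFun P * ((K P).toFun a * f a) := fun P hP => by
    rw [ev_eq _ _ t ((Finset.subset_biUnion_of_mem (fun P => (K P).supp) hP).trans
      Finset.subset_union_right), Finset.mul_sum]
  rw [Finset.sum_congr rfl h4, Finset.sum_comm]
  refine Finset.sum_congr rfl fun a _ => ?_
  rw [h3, Finset.sum_mul]
  exact Finset.sum_congr rfl fun i _ => by ring

/-! ## The characteristics are affine -/

theorem mass_nonneg' (μ : FinDist Tm) (φ : Set Tm) : 0 ≤ μ.mass φ := by
  rw [mass_eq]; exact le_ev _ fun a _ => by split_ifs <;> simp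

theorem mass_le_one' (μ : FinDist Tm) (φ : Set Tm) : μ.mass φ ≤ 1 := by
  rw [mass_eq]; exact ev_le _ fun a _ => by split_ifs <;> simp

theorem le_chiMay {μ ν : FinDist Tm} (h : Internal μ ν) : ν.mass psiL ≤ chiMayL μ :=
  le_csSup ⟨1, by rintro x ⟨ν, _, rfl⟩; exact mass_le_one' _ _⟩ ⟨ν, h, rfl⟩

theorem chiMay_le {μ : FinDist Tm} {c : ℝ} (h : ∀ ν, Internal μ ν → ν.mass psiL ≤ c) :
    chiMayL μ ≤ c :=
  csSup_le ⟨_, μ, Internal.refl' μ, rfl⟩ (by rintro x ⟨ν, h1, rfl⟩; exact h ν h1)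

theorem chiMay_nonneg (μ : FinDist Tm) : 0 ≤ chiMayL μ :=
  (mass_nonneg' μ psiL).trans (le_chiMay (Internal.refl' μ))

theorem chiMay_le_one (μ : FinDist Tm) : chiMayL μ ≤ 1 :=
  chiMay_le fun ν _ => mass_le_one' ν psiL

theorem chiMay_anti {μ ν : FinDist Tm} (h : Internal μ ν) : chiMayL ν ≤ chiMayL μ :=
  chiMay_le fun _ h' => le_chiMay (h.trans' h')

theorem chiFair_le {μ ν : FinDist Tm} (h : Internal μ ν) : chiFairL μ ≤ chiMayL ν :=
  csInf_le ⟨0, by rintro x ⟨ν, _, rfl⟩; exact chiMay_nonneg _⟩ ⟨ν, h, rfl⟩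

theorem le_chiFair {μ : FinDist Tm} {c : ℝ} (h : ∀ ν, Internal μ ν → c ≤ chiMayL ν) :
    c ≤ chiFairL μ :=
  le_csInf ⟨_, μ, Internal.refl' μ, rfl⟩ (by rintro x ⟨ν, h1, rfl⟩; exact h ν h1)

theorem chiFair_mono {μ ν : FinDist Tm} (h : Internal μ ν) : chiFairL μ ≤ chiFairL ν :=
  le_chiFair fun _ h' => chiFair_le (h.trans' h')

/-- May characteristic of a term. -/
noncomputable def may (P : Tm) : ℝ := chiMayL (dirac P)

/-- Fair characteristic of a term. -/
noncomputable def fair (P : Tm) : ℝ := chiFairL (dirac P)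

theorem ev_may_le (μ : FinDist Tm) : μ.ev may ≤ chiMayL μ := by
  apply le_of_forall_pos_le_add
  intro ε hε
  have : ∀ P, ∃ ν, Internal (dirac P) ν ∧ may P - ε < ν.mass psiL := by
    intro P
    by_contra hn
    push Not at hn
    have := chiMay_le hn
    unfold may at this
    linarith
  choose K h1 h2 using this
  obtain ⟨ν, h3, h4⟩ := internal_bind μ K h1
  have h5 := le_chiMay h3
  rw [mass_eq, h4] at h5
  have h6 : μ.ev may ≤ μ.ev (fun P => (K P).mass psiL + ε) :=
    ev_mono _ fun P _ => by linarith [h2 P]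
  rw [ev_add, ev_const] at h6
  simp only [mass_eq] at h6
  linarith

theorem may_psi {P : Tm} (h : P ∈ psiL) : may P = 1 := by
  apply le_antisymm (chiMay_le_one _)
  have := le_chiMay (Internal.refl' (dirac P))
  rwa [mass_eq, ev_dirac, if_pos h] at this

theorem may_nonneg (P : Tm) : 0 ≤ may P := chiMay_nonneg _
theorem may_le_one (P : Tm) : may P ≤ 1 := chiMay_le_one _

theorem may_step {P : Tm} {ρ : FinDist Tm} (h : Step P .tau ρ) : ρ.ev may ≤ may P :=
  (ev_may_le ρ).trans (chiMay_anti (internal_of_step h))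

theorem chiMay_le_ev {f : Tm → ℝ} (h0 : ∀ P, 0 ≤ f P) (h1 : ∀ P ∈ psiL, 1 ≤ f P)
    (hf : ∀ P ρ, Step P .tau ρ → ρ.ev f ≤ f P) (μ : FinDist Tm) : chiMayL μ ≤ μ.ev f := by
  apply chiMay_le
  intro ν hν
  refine le_trans ?_ (ev_le_of_internal hf hν)
  rw [mass_eq]
  refine ev_mono _ fun a _ => ?_
  split_ifs with h
  · exact h1 a h
  · exact h0 a

theorem chiMay_eq (μ : FinDist Tm) : chiMayL μ = μ.ev may :=
  le_antisymm (chiMay_le_ev may_nonneg (fun _ h => (may_psi h).ge) (fun _ _ => may_step) μ)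
    (ev_may_le μ)

theorem may_least {f : Tm → ℝ} (h0 : ∀ P, 0 ≤ f P) (h1 : ∀ P ∈ psiL, 1 ≤ f P)
    (hf : ∀ P ρ, Step P .tau ρ → ρ.ev f ≤ f P) (P : Tm) : may P ≤ f P := by
  have := chiMay_le_ev h0 h1 hf (dirac P)
  rwa [ev_dirac] at this

theorem chiFair_le_ev (μ : FinDist Tm) : chiFairL μ ≤ μ.ev fair := by
  apply le_of_forall_pos_le_add
  intro ε hε
  have : ∀ P, ∃ ν, Internal (dirac P) ν ∧ chiMayL ν < fair P + ε := by
    intro P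
    by_contra hn
    push Not at hn
    have := le_chiFair hn
    unfold fair at this
    linarith
  choose K h1 h2 using this
  obtain ⟨ν, h3, h4⟩ := internal_bind μ K h1
  have h5 := chiFair_le h3
  rw [chiMay_eq, h4] at h5
  have h6 : μ.ev (fun P => (K P).ev may) ≤ μ.ev (fun P => fair P + ε) :=
    ev_mono _ fun P _ => by rw [← chiMay_eq]; exact (h2 P).le
  rw [ev_add, ev_const] at h6
  linarith

theorem fair_step {P : Tm} {ρ : FinDist Tm} (h : Step P .tau ρ) : fair P ≤ ρ.ev fair :=
  (chiFair_mono (internal_of_step h)).trans (chiFair_le_ev ρ)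

theorem fair_le_may (P : Tm) : fair P ≤ may P := chiFair_le (Internal.refl' _)

theorem fair_nonneg (P : Tm) : 0 ≤ fair P := le_chiFair fun _ _ => chiMay_nonneg _

theorem fair_le_one (P : Tm) : fair P ≤ 1 := (fair_le_may P).trans (may_le_one P)

theorem ev_le_chiFair {g : Tm → ℝ} (h1 : ∀ P, g P ≤ may P)
    (hg : ∀ P ρ, Step P .tau ρ → g P ≤ ρ.ev g) (μ : FinDist Tm) : μ.ev g ≤ chiFairL μ := by
  apply le_chiFair
  intro ν hν
  rw [chiMay_eq]
  refine le_trans ?_ (ev_mono ν fun P _ => h1 P)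
  have := ev_le_of_internal (f := fun P => - g P)
    (fun P ρ h => by rw [ev_neg]; exact neg_le_neg (hg P ρ h)) hν
  rw [ev_neg, ev_neg] at this
  linarith

theorem chiFair_eq (μ : FinDist Tm) : chiFairL μ = μ.ev fair :=
  le_antisymm (chiFair_le_ev μ) (ev_le_chiFair fair_le_may (fun _ _ => fair_step) μ)

theorem fair_greatest {g : Tm → ℝ} (h1 : ∀ P, g P ≤ may P)
    (hg : ∀ P ρ, Step P .tau ρ → g P ≤ ρ.ev g) (P : Tm) : g P ≤ fair P := by
  have := ev_le_chiFair h1 hg (dirac P)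
  rwa [ev_dirac] at this

/-! ## Substitution and syntactic invariants -/

theorem closedAt_mono {T : Tm} : ∀ {n m : ℕ}, n ≤ m → T.ClosedAt n → T.ClosedAt m := by
  induction T with
  | nil => intros; trivial
  | var k => intro n m h h1; exact lt_of_lt_of_le h1 h
  | sum k a c ih => intro n m h h1 i; exact ih i h (h1 i)
  | oplus k a c ih => intro n m h h1 i; exact ih i h (h1 i)
  | par S T ih1 ih2 => intro n m h h1; exact ⟨ih1 h h1.1, ih2 h h1.2⟩
  | loc L T ih => intro n m h h1; exact ih (n := n) (m := m) h h1
  | fix T ih => intro n m h h1; exact ih (n := n + 1) (m := m + 1) (by omega) h1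

theorem subst_closed (P : Tm) {T : Tm} : ∀ {n m : ℕ}, n ≤ m → T.ClosedAt n →
    Tm.subst P m T = T := by
  induction T with
  | nil => intros; rfl
  | var k =>
    intro n m h h1
    have : k < n := h1
    have : k ≠ m := by omega
    simp [Tm.subst, this]
  | sum k a c ih =>
    intro n m h h1
    simp only [Tm.subst, Tm.sum.injEq, heq_eq_eq, true_and]
    exact funext fun i => ih i h (h1 i)
  | oplus k a c ih =>
    intro n m h h1
    simp only [Tm.subst, Tm.oplus.injEq, heq_eq_eq, true_and]
    exact funext fun i => ih i h (h1 i)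
  | par S T ih1 ih2 =>
    intro n m h h1
    simp only [Tm.subst]
    rw [ih1 h h1.1, ih2 h h1.2]
  | loc L T ih =>
    intro n m h h1
    simp only [Tm.subst]
    rw [ih (n := n) h h1]
  | fix T ih =>
    intro n m h h1
    simp only [Tm.subst]
    rw [ih (n := n + 1) (by omega) h1]

theorem closedAt_subst {P : Tm} (hP : P.ClosedAt 0) {T : Tm} : ∀ {n : ℕ}, T.ClosedAt (n + 1) →
    (Tm.subst P n T).ClosedAt n := by
  induction T with
  | nil => intros; trivial
  | var k =>
    intro n h1
    have : k < n + 1 := h1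
    simp only [Tm.subst]
    split_ifs with h
    · exact closedAt_mono (Nat.zero_le _) hP
    · show k < n
      omega
  | sum k a c ih => intro n h1 i; exact ih i (h1 i)
  | oplus k a c ih => intro n h1 i; exact ih i (h1 i)
  | par S T ih1 ih2 => intro n h1; exact ⟨ih1 h1.1, ih2 h1.2⟩
  | loc L T ih => intro n h1; exact ih (n := n) h1
  | fix T ih => intro n h1; exact ih (n := n + 1) h1

theorem noOmega_subst {P : Tm} (hP : P.NoOmega) {T : Tm} : ∀ {n : ℕ}, T.NoOmega →
    (Tm.subst P n T).NoOmega := by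
  induction T with
  | nil => intros; trivial
  | var k =>
    intro n h1
    simp only [Tm.subst]
    split_ifs with h
    · exact hP
    · trivial
  | sum k a c ih => intro n h1; exact ⟨h1.1, fun i => ih i (h1.2 i)⟩
  | oplus k a c ih => intro n h1 i; exact ih i (h1 i)
  | par S T ih1 ih2 => intro n h1; exact ⟨ih1 h1.1, ih2 h1.2⟩
  | loc L T ih => intro n h1; exact ih (n := n) h1
  | fix T ih => intro n h1; exact ih (n := n + 1) h1

theorem chans_subst {P : Tm} {L : Finset Chan} (hP : P.chans ⊆ L) {T : Tm} :
    ∀ {n : ℕ}, T.chans ⊆ L → (Tm.subst P n T).chans ⊆ L := by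
  induction T with
  | nil => intro n h; exact h
  | var k =>
    intro n h1
    simp only [Tm.subst]
    split_ifs with h
    · exact hP
    · exact h1
  | sum k a c ih =>
    intro n h1
    simp only [Tm.subst, Tm.chans] at h1 ⊢
    refine Finset.union_subset (Finset.union_subset_left h1) ?_
    refine Finset.sup_le fun i _ => ih i ?_
    exact le_trans (Finset.le_sup (f := fun i => (c i).chans) (Finset.mem_univ i))
      (Finset.union_subset_right h1)
  | oplus k a c ih =>
    intro n h1
    simp only [Tm.subst, Tm.chans] at h1 ⊢
    refine Finset.sup_le fun i _ => ih i ?_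
    exact le_trans (Finset.le_sup (f := fun i => (c i).chans) (Finset.mem_univ i)) h1
  | par S T ih1 ih2 =>
    intro n h1
    exact Finset.union_subset (ih1 (Finset.union_subset_left h1))
      (ih2 (Finset.union_subset_right h1))
  | loc L T ih =>
    intro n h1
    exact Finset.union_subset (Finset.union_subset_left h1)
      (ih (Finset.union_subset_right h1))
  | fix T ih => intro n h1; exact ih (n := n + 1) h1

theorem isProc_unfold {T : Tm} (h : (Tm.fix T).IsProc) : (Tm.subst (.fix T) 0 T).IsProc :=
  ⟨closedAt_subst h.1 h.1, noOmega_subst h.2 h.2⟩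

theorem oplus_ev {k : ℕ} {w : Fin (k+1) → ℝ} {c : Fin (k+1) → Tm} {ρ : FinDist Tm}
    (h : ∀ Q, ρ.toFun Q = ∑ i, if c i = Q then w i else 0) (f : Tm → ℝ) :
    ρ.ev f = ∑ i, w i * f (c i) := by
  have := ev_lin w (fun i => dirac (c i)) ρ (fun Q => by
    rw [h]
    refine Finset.sum_congr rfl fun i _ => ?_
    by_cases hq : c i = Q
    · simp [hq, dirac]
    · have : Q ≠ c i := fun h => hq h.symm
      simp [hq, this, dirac]) f
  simpa only [ev_dirac] using this

theorem oplus_ne {k : ℕ} {w : Fin (k+1) → ℝ} {c : Fin (k+1) → Tm} {ρ : FinDist Tm}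
    (h : ∀ Q, ρ.toFun Q = ∑ i, if c i = Q then w i else 0) {Q : Tm} (hQ : ρ.toFun Q ≠ 0) :
    ∃ i, c i = Q := by
  rw [h] at hQ
  obtain ⟨i, _, hi⟩ := Finset.exists_ne_zero_of_sum_ne_zero hQ
  refine ⟨i, ?_⟩
  by_contra hn
  simp [hn] at hi

theorem step_isProc {P : Tm} {α : Act} {ρ : FinDist Tm} (h : Step P α ρ) (hP : P.IsProc) :
    ρ.IsProcDist := by
  induction h with
  | choice acts conts i =>
    intro Q hQ
    rw [dirac_ne hQ]
    exact ⟨hP.1 i, hP.2.2 i⟩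
  | oplus w conts ρ h1 h2 =>
    intro Q hQ
    obtain ⟨i, rfl⟩ := oplus_ne h2 hQ
    exact ⟨hP.1 i, hP.2 i⟩
  | parL T h ih =>
    intro Q hQ
    obtain ⟨A, B, h1, h2, rfl⟩ := parD_ne hQ
    rw [dirac_ne h2]
    have := ih ⟨hP.1.1, hP.2.1⟩ A h1
    exact ⟨⟨this.1, hP.1.2⟩, ⟨this.2, hP.2.2⟩⟩
  | parR T h ih =>
    intro Q hQ
    obtain ⟨A, B, h1, h2, rfl⟩ := parD_ne hQ
    rw [dirac_ne h1]
    have := ih ⟨hP.1.2, hP.2.2⟩ B h2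
    exact ⟨⟨hP.1.1, this.1⟩, ⟨hP.2.1, this.2⟩⟩
  | comm hc _ _ ih1 ih2 =>
    intro Q hQ
    obtain ⟨A, B, h1, h2, rfl⟩ := parD_ne hQ
    have t1 := ih1 ⟨hP.1.1, hP.2.1⟩ A h1
    have t2 := ih2 ⟨hP.1.2, hP.2.2⟩ B h2
    exact ⟨⟨t1.1, t2.1⟩, ⟨t1.2, t2.2⟩⟩
  | loc L h hb ih =>
    intro Q hQ
    obtain ⟨A, h1, rfl⟩ := locD_ne hQ
    exact ih hP A h1
  | fixp h ih => exact ih (isProc_unfold hP)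

theorem step_chans {P : Tm} {α : Act} {ρ : FinDist Tm} (h : Step P α ρ) {L : Finset Chan}
    (hP : P.chans ⊆ L) : α.chans ⊆ L ∧ ∀ Q, ρ.toFun Q ≠ 0 → Q.chans ⊆ L := by
  induction h with
  | choice acts conts i =>
    constructor
    · exact le_trans (Finset.le_sup (f := fun i => (acts i).chans) (Finset.mem_univ i))
        (Finset.union_subset_left hP)
    · intro Q hQ
      rw [dirac_ne hQ]
      exact le_trans (Finset.le_sup (f := fun i => (conts i).chans) (Finset.mem_univ i))
        (Finset.union_subset_right hP)
  | oplus w conts ρ h1 h2 =>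
    refine ⟨Finset.empty_subset _, fun Q hQ => ?_⟩
    obtain ⟨i, rfl⟩ := oplus_ne h2 hQ
    exact le_trans (Finset.le_sup (f := fun i => (conts i).chans) (Finset.mem_univ i)) hP
  | parL T h ih =>
    have := ih (Finset.union_subset_left hP)
    refine ⟨this.1, fun Q hQ => ?_⟩
    obtain ⟨A, B, h1, h2, rfl⟩ := parD_ne hQ
    rw [dirac_ne h2]
    exact Finset.union_subset (this.2 A h1) (Finset.union_subset_right hP)
  | parR T h ih =>
    have := ih (Finset.union_subset_right hP)
    refine ⟨this.1, fun Q hQ => ?_⟩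
    obtain ⟨A, B, h1, h2, rfl⟩ := parD_ne hQ
    rw [dirac_ne h1]
    exact Finset.union_subset (Finset.union_subset_left hP) (this.2 B h2)
  | comm hc _ _ ih1 ih2 =>
    refine ⟨Finset.empty_subset _, fun Q hQ => ?_⟩
    obtain ⟨A, B, h1, h2, rfl⟩ := parD_ne hQ
    exact Finset.union_subset ((ih1 (Finset.union_subset_left hP)).2 A h1)
      ((ih2 (Finset.union_subset_right hP)).2 B h2)
  | loc L h hb ih =>
    have := ih (Finset.union_subset_right hP)
    refine ⟨this.1, fun Q hQ => ?_⟩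
    obtain ⟨A, h1, rfl⟩ := locD_ne hQ
    exact Finset.union_subset (Finset.union_subset_left hP) (this.2 A h1)
  | fixp h ih => exact ih (chans_subst hP hP)

/-! ## Contextual equality with respect to a characteristic -/

/-- Static contexts, innermost frame first. -/
abbrev Frames := List ({R : Tm // R.IsProc} ⊕ Finset Chan)

/-- Filling a static context. -/
def fill : Frames → Tm → Tm
  | [], X => X
  | .inl R :: C, X => fill C (.par X R.1)
  | .inr L :: C, X => fill C (.loc L X)

/-- Equality of a characteristic in all static contexts. -/
def CEq (χ : Tm → ℝ) (P Q : Tm) : Prop := ∀ C : Frames, χ (fill C P) = χ (fill C Q)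

theorem CEq.refl (χ : Tm → ℝ) (P : Tm) : CEq χ P P := fun _ => rfl
theorem CEq.symm {χ : Tm → ℝ} {P Q : Tm} (h : CEq χ P Q) : CEq χ Q P := fun C => (h C).symm
theorem CEq.trans {χ : Tm → ℝ} {P Q R : Tm} (h : CEq χ P Q) (h' : CEq χ Q R) : CEq χ P R :=
  fun C => (h C).trans (h' C)
theorem CEq.par {χ : Tm → ℝ} {P Q R : Tm} (h : CEq χ P Q) (hR : R.IsProc) :
    CEq χ (.par P R) (.par Q R) := fun C => h (.inl ⟨R, hR⟩ :: C)
theorem CEq.loc {χ : Tm → ℝ} {P Q : Tm} (h : CEq χ P Q) (L : Finset Chan) :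
    CEq χ (.loc L P) (.loc L Q) := fun C => h (.inr L :: C)

theorem fill_append (C C' : Frames) (X : Tm) : fill (C ++ C') X = fill C' (fill C X) := by
  induction C generalizing X with
  | nil => rfl
  | cons fr C ih =>
    cases fr with
    | inl R => exact ih _
    | inr L => exact ih _

theorem CEq.fill {χ : Tm → ℝ} {P Q : Tm} (h : CEq χ P Q) (C : Frames) :
    CEq χ (fill C P) (fill C Q) := fun C' => by
  rw [← fill_append, ← fill_append]; exact h _

theorem fill_isProc (C : Frames) {X : Tm} (h : X.IsProc) : (fill C X).IsProc := by
  induction C generalizing X with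
  | nil => exact h
  | cons fr C ih =>
    cases fr with
    | inl R => exact ih ⟨⟨h.1, R.2.1⟩, ⟨h.2, R.2.2⟩⟩
    | inr L => exact ih h

theorem isProc_fullCtx {R : Tm} (h : R.IsProc) : dirac R ∈ fullCtx := by
  intro Q hQ; rw [dirac_ne hQ]; exact h

theorem ceq_of_rel {χ : Tm → ℝ} {R : FinDist Tm → FinDist Tm → Prop}
    (h1 : ∀ P Q, R (dirac P) (dirac Q) → χ P = χ Q) (h2 : DExtensional fullCtx R)
    {P Q : Tm} (h : R (dirac P) (dirac Q)) : CEq χ P Q := by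
  intro C
  induction C generalizing P Q with
  | nil => exact h1 _ _ h
  | cons fr C ih =>
    cases fr with
    | inl T =>
      apply ih
      have := (h2 _ _ h).1 _ (isProc_fullCtx T.2)
      rwa [parD_dirac, parD_dirac] at this
    | inr L =>
      apply ih
      have := (h2 _ _ h).2 L
      rwa [locD_dirac, locD_dirac] at this

theorem rel_of_ceq {χ : Tm → ℝ} {χD : FinDist Tm → ℝ} (hχ : ∀ μ, χD μ = μ.ev χ)
    {P Q : Tm} (h : CEq χ P Q) :
    ∃ R : FinDist Tm → FinDist Tm → Prop, (∀ μ1 μ2, R μ1 μ2 → χD μ1 = χD μ2) ∧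
      DExtensional fullCtx R ∧ R (dirac P) (dirac Q) := by
  refine ⟨fun μ1 μ2 => ∀ C, μ1.ev (fun X => χ (fill C X)) = μ2.ev (fun X => χ (fill C X)),
    ?_, ?_, ?_⟩
  · intro μ1 μ2 h
    rw [hχ, hχ]
    exact h []
  · intro μ1 μ2 h
    constructor
    · intro ν hν C
      rw [ev_parD, ev_parD, ev_swap, ev_swap μ2]
      refine ev_congr _ fun T hT => ?_
      exact h (.inl ⟨T, hν T hT⟩ :: C)
    · intro L C
      rw [ev_locD, ev_locD]
      exact h (.inr L :: C)
  · intro C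
    rw [ev_dirac, ev_dirac]
    exact h C

theorem diamond_iff (P Q : Tm) : DiamondEq fullCtx (dirac P) (dirac Q) ↔ CEq may P Q := by
  constructor
  · rintro ⟨R, h1, h2, h3⟩
    exact ceq_of_rel (fun P Q h => h1 _ _ h) h2 h3
  · intro h
    obtain ⟨R, h1, h2, h3⟩ := rel_of_ceq chiMay_eq h
    exact ⟨R, h1, h2, h3⟩

theorem box_iff (P Q : Tm) : BoxEq fullCtx (dirac P) (dirac Q) ↔ CEq fair P Q := by
  constructor
  · rintro ⟨R, h1, h2, h3⟩
    exact ceq_of_rel (fun P Q h => h1 _ _ h) h2 h3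
  · intro h
    obtain ⟨R, h1, h2, h3⟩ := rel_of_ceq chiFair_eq h
    exact ⟨R, h1, h2, h3⟩

/-! ## Lifting and simulation -/

/-- Dual form of lifting of a relation. -/
def DLift (R : Tm → Tm → Prop) (ρ ρ' : FinDist Tm) : Prop :=
  ∀ f g : Tm → ℝ, (∀ x y, R x y → f x ≤ g y) → ρ.ev f ≤ ρ'.ev g

theorem DLift.mono {R S : Tm → Tm → Prop} {ρ ρ' : FinDist Tm} (h : DLift R ρ ρ')
    (hRS : ∀ x y, R x y → S x y) : DLift S ρ ρ' :=
  fun f g hfg => h f g fun x y hxy => hfg x y (hRS x y hxy)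

theorem DLift.swap {R : Tm → Tm → Prop} {ρ ρ' : FinDist Tm} (h : DLift R ρ ρ') :
    DLift (fun x y => R y x) ρ' ρ := by
  intro f g hfg
  have := h (fun x => - g x) (fun y => - f y) fun x y hxy => neg_le_neg (hfg y x hxy)
  rw [ev_neg, ev_neg] at this
  linarith

theorem DLift.dirac {R : Tm → Tm → Prop} {X Y : Tm} (h : R X Y) :
    DLift R (dirac X) (dirac Y) := by
  intro f g hfg
  rw [ev_dirac, ev_dirac]
  exact hfg _ _ h

theorem DLift.refl {R : Tm → Tm → Prop} (ρ : FinDist Tm) (h : ∀ x, ρ.toFun x ≠ 0 → R x x) :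
    DLift R ρ ρ := by
  intro f g hfg
  exact ev_mono _ fun x hx => hfg x x (h x hx)

theorem DLift.par {R S U : Tm → Tm → Prop} {ρ ρ' σ σ' : FinDist Tm} (h : DLift R ρ ρ')
    (h' : DLift S σ σ') (hU : ∀ x y a b, R x y → S a b → U (.par x a) (.par y b)) :
    DLift U (ρ.parD σ) (ρ'.parD σ') := by
  intro f g hfg
  rw [ev_parD, ev_parD]
  apply h
  intro x y hxy
  apply h'
  intro a b hab
  exact hfg _ _ (hU _ _ _ _ hxy hab)

theorem DLift.loc {R U : Tm → Tm → Prop} {ρ ρ' : FinDist Tm} (L : Finset Chan)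
    (h : DLift R ρ ρ') (hU : ∀ x y, R x y → U (.loc L x) (.loc L y)) :
    DLift U (locD L ρ) (locD L ρ') := by
  intro f g hfg
  rw [ev_locD, ev_locD]
  apply h
  intro x y hxy
  exact hfg _ _ (hU _ _ hxy)

/-- Simulation principle for `may`. -/
theorem may_sim (R : Tm → Tm → Prop)
    (h1 : ∀ X Y, R X Y → X ∈ psiL → may Y = 1)
    (h2 : ∀ X Y, R X Y → ∀ ρ, Step X .tau ρ → ∃ ρ', ρ'.ev may ≤ may Y ∧
      DLift (fun x y => R x y ∨ may x ≤ may y) ρ ρ') :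
    ∀ X Y, R X Y → may X ≤ may Y := by
  let f : Tm → ℝ := fun X => sInf {r | ∃ Y, (R X Y ∨ may X ≤ may Y) ∧ r = may Y}
  have hb : ∀ X, BddBelow {r | ∃ Y, (R X Y ∨ may X ≤ may Y) ∧ r = may Y} := fun X =>
    ⟨0, by rintro r ⟨Y, _, rfl⟩; exact may_nonneg _⟩
  have hf : ∀ X Y, (R X Y ∨ may X ≤ may Y) → f X ≤ may Y := fun X Y h =>
    csInf_le (hb X) ⟨Y, h, rfl⟩
  have hg : ∀ X c, (∀ Y, (R X Y ∨ may X ≤ may Y) → c ≤ may Y) → c ≤ f X := fun X c h =>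
    le_csInf ⟨_, X, Or.inr le_rfl, rfl⟩ (by rintro r ⟨Y, h1, rfl⟩; exact h Y h1)
  have key := may_least (f := f) (fun X => hg X 0 fun Y _ => may_nonneg Y)
    (fun X hX => hg X 1 fun Y hY => by
      rcases hY with hY | hY
      · exact (h1 X Y hY hX).ge
      · rwa [may_psi hX] at hY)
    (fun X ρ hs => hg X _ fun Y hY => by
      rcases hY with hY | hY
      · obtain ⟨ρ', h3, h4⟩ := h2 X Y hY ρ hs
        exact (h4 f may hf).trans h3
      · exact ((ev_mono ρ fun x _ => hf x x (Or.inr le_rfl)).trans (may_step hs)).trans hY)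
  exact fun X Y h => (key X).trans (hf X Y (Or.inl h))

/-- Simulation principle for `fair`. -/
theorem fair_sim (R : Tm → Tm → Prop)
    (h1 : ∀ X Y, R X Y → may X ≤ may Y)
    (h2 : ∀ X Y, R X Y → ∀ ρ', Step Y .tau ρ' → ∃ ρ, fair X ≤ ρ.ev fair ∧
      DLift (fun x y => R x y ∨ fair x ≤ fair y) ρ ρ') :
    ∀ X Y, R X Y → fair X ≤ fair Y := by
  let g : Tm → ℝ := fun Y => sSup {r | ∃ X, (R X Y ∨ fair X ≤ fair Y) ∧ r = fair X}
  have hb : ∀ Y, BddAbove {r | ∃ X, (R X Y ∨ fair X ≤ fair Y) ∧ r = fair X} := fun X =>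
    ⟨1, by rintro r ⟨Y, _, rfl⟩; exact fair_le_one _⟩
  have hf : ∀ X Y, (R X Y ∨ fair X ≤ fair Y) → fair X ≤ g Y := fun X Y h =>
    le_csSup (hb Y) ⟨X, h, rfl⟩
  have hg : ∀ Y c, (∀ X, (R X Y ∨ fair X ≤ fair Y) → fair X ≤ c) → g Y ≤ c := fun Y c h =>
    csSup_le ⟨_, Y, Or.inr le_rfl, rfl⟩ (by rintro r ⟨X, h1, rfl⟩; exact h X h1)
  have key := fair_greatest (g := g)
    (fun Y => hg Y _ fun X hX => by
      rcases hX with hX | hX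
      · exact (fair_le_may X).trans (h1 X Y hX)
      · exact hX.trans (fair_le_may Y))
    (fun Y ρ' hs => hg Y _ fun X hX => by
      rcases hX with hX | hX
      · obtain ⟨ρ, h3, h4⟩ := h2 X Y hX ρ' hs
        exact h3.trans (h4 fair g hf)
      · exact (hX.trans (fair_step hs)).trans (ev_mono ρ' fun x _ => hf x x (Or.inr le_rfl)))
  exact fun X Y h => (hf X Y (Or.inl h)).trans (key Y)

/-- Closure of a relation under static contexts. -/
inductive Clo (R : Tm → Tm → Prop) : Tm → Tm → Prop where
  | base {X Y : Tm} : R X Y → Clo R X Y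
  | par {X Y T : Tm} : Clo R X Y → T.IsProc → Clo R (.par X T) (.par Y T)
  | loc {X Y : Tm} (L : Finset Chan) : Clo R X Y → Clo R (.loc L X) (.loc L Y)

theorem Clo.fill {R : Tm → Tm → Prop} {X Y : Tm} (h : Clo R X Y) (C : Frames) :
    Clo R (fill C X) (fill C Y) := by
  induction C generalizing X Y with
  | nil => exact h
  | cons fr C ih =>
    cases fr with
    | inl T => exact ih (h.par T.2)
    | inr L => exact ih (h.loc L)

/-- `R` progresses to itself or to contextual equality. -/
def Prog (χ : Tm → ℝ) (R S : Tm → Tm → Prop) : Prop :=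
  ∀ X Y, R X Y → ∀ α ρ, Step X α ρ → ∃ ρ', Step Y α ρ' ∧
    DLift (fun x y => S x y ∨ CEq χ x y) ρ ρ'

theorem Prog.clo {χ : Tm → ℝ} {R : Tm → Tm → Prop} (h : Prog χ R R) :
    Prog χ (Clo R) (Clo R) := by
  intro X Y hXY
  have hpar : ∀ {x y T : Tm}, (Clo R x y ∨ CEq χ x y) → T.IsProc →
      (Clo R (.par x T) (.par y T) ∨ CEq χ (.par x T) (.par y T)) := by
    rintro x y T (h | h) hT
    · exact Or.inl (h.par hT)
    · exact Or.inr (h.par hT)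
  induction hXY with
  | base h0 =>
    intro α ρ hs
    obtain ⟨ρ', h1, h2⟩ := h _ _ h0 α ρ hs
    exact ⟨ρ', h1, h2.mono fun x y hxy => hxy.imp Clo.base id⟩
  | @par X Y T h0 hT ih =>
    intro α ρ hs
    cases hs with
    | parL _ hs =>
      obtain ⟨ρ', h1, h2⟩ := ih _ _ hs
      refine ⟨_, Step.parL T h1, h2.par (DLift.dirac (R := fun a b => a = b ∧ a.IsProc) ⟨rfl, hT⟩) ?_⟩
      rintro x y a b hxy ⟨rfl, ha⟩
      exact hpar hxy ha
    | parR _ hs =>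
      refine ⟨_, Step.parR Y hs, (DLift.dirac h0).par
        (DLift.refl (R := fun a b => a = b ∧ a.IsProc) _
          fun x hx => ⟨rfl, step_isProc hs hT x hx⟩) ?_⟩
      rintro x y a b hxy ⟨rfl, ha⟩
      exact Or.inl (hxy.par ha)
    | comm hc hs1 hs2 =>
      obtain ⟨ρ', h1, h2⟩ := ih _ _ hs1
      refine ⟨_, Step.comm hc h1 hs2, h2.par
        (DLift.refl (R := fun a b => a = b ∧ a.IsProc) _
          fun x hx => ⟨rfl, step_isProc hs2 hT x hx⟩) ?_⟩
      rintro x y a b hxy ⟨rfl, ha⟩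
      exact hpar hxy ha
  | @loc X Y L h0 ih =>
    intro α ρ hs
    cases hs with
    | loc _ hs hb =>
      obtain ⟨ρ', h1, h2⟩ := ih _ _ hs
      refine ⟨_, Step.loc L h1 hb, h2.loc L ?_⟩
      rintro x y (h | h)
      · exact Or.inl (h.loc L)
      · exact Or.inr (h.loc L)

theorem psi_of_prog {χ : Tm → ℝ} {R S : Tm → Tm → Prop} (h : Prog χ R S) {X Y : Tm}
    (hXY : R X Y) (hX : X ∈ psiL) : Y ∈ psiL := by
  obtain ⟨α, ρ, h1, h2⟩ := hX
  obtain ⟨ρ', h3, _⟩ := h _ _ hXY _ _ h2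
  exact ⟨α, ρ', h1, h3⟩

theorem ceq_may_of_prog {R : Tm → Tm → Prop} (hsym : ∀ X Y, R X Y → R Y X)
    (h : Prog may R R) {X Y : Tm} (hXY : R X Y) : CEq may X Y := by
  have key : ∀ X Y, Clo R X Y → may X ≤ may Y := may_sim (Clo R)
    (fun X Y h0 hX => may_psi (psi_of_prog h.clo h0 hX))
    (fun X Y h0 ρ hs => by
      obtain ⟨ρ', h1, h2⟩ := h.clo _ _ h0 _ _ hs
      exact ⟨ρ', may_step h1, h2.mono fun x y hxy => hxy.imp id fun h => (h []).le⟩)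
  exact fun C => le_antisymm (key _ _ ((Clo.base hXY).fill C))
    (key _ _ ((Clo.base (hsym _ _ hXY)).fill C))

theorem ceq_fair_of_prog {R : Tm → Tm → Prop} (hsym : ∀ X Y, R X Y → R Y X)
    (hm : ∀ X Y, R X Y → CEq may X Y)
    (h : Prog fair R R) {X Y : Tm} (hXY : R X Y) : CEq fair X Y := by
  have hcm : ∀ X Y, Clo R X Y → CEq may X Y := by
    intro X Y h0
    induction h0 with
    | base h => exact hm _ _ h
    | par _ hT ih => exact ih.par hT
    | loc L _ ih => exact ih.loc L
  have hcs : ∀ X Y, Clo R X Y → Clo R Y X := by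
    intro X Y h0
    induction h0 with
    | base h => exact .base (hsym _ _ h)
    | par _ hT ih => exact ih.par hT
    | loc L _ ih => exact ih.loc L
  have key : ∀ X Y, Clo R X Y → fair X ≤ fair Y := fair_sim (Clo R)
    (fun X Y h0 => (hcm X Y h0 []).le)
    (fun X Y h0 ρ' hs => by
      obtain ⟨ρ, h1, h2⟩ := h.clo _ _ (hcs _ _ h0) _ _ hs
      refine ⟨ρ, fair_step h1, h2.swap.mono fun x y hxy => ?_⟩
      rcases hxy with h | h
      · exact Or.inl (hcs _ _ h)
      · exact Or.inr (h []).ge)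
  exact fun C => le_antisymm (key _ _ ((Clo.base hXY).fill C))
    (key _ _ ((Clo.base (hsym _ _ hXY)).fill C))

/-! ## Box equality implies diamond equality -/

/-- The process that reports on the fresh channel `N`. -/
def tBeep (N : ℕ) : Tm := .sum 0 (fun _ => .inp N) (fun _ => .nil)

/-- The test that is killed by any communication on a channel below `N`. -/
def tObs (N : ℕ) : Tm :=
  .sum (2 * N)
    (fun i => if i.1 < N then .inp i.1 else if i.1 < 2 * N then .out (i.1 - N) else .tau)
    (fun i => if i.1 < 2 * N then .nil else tBeep N)

theorem tObs_isProc (N : ℕ) : (tObs N).IsProc := by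
  refine ⟨fun i => ?_, fun i => ?_, fun i => ?_⟩
  · show Tm.ClosedAt 0 (if i.1 < 2 * N then .nil else tBeep N)
    split_ifs
    · trivial
    · exact fun _ => trivial
  · show (if i.1 < N then Act.inp i.1 else if i.1 < 2 * N then .out (i.1 - N) else .tau) ≠ .omega
    split_ifs <;> simp
  · show Tm.NoOmega (if i.1 < 2 * N then .nil else tBeep N)
    split_ifs
    · trivial
    · exact ⟨fun _ => by simp, fun _ => trivial⟩

theorem tObs_tau (N : ℕ) : Step (tObs N) .tau (dirac (tBeep N)) := by
  have := Step.choice (k := 2 * N)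
    (fun i => if i.1 < N then .inp i.1 else if i.1 < 2 * N then .out (i.1 - N) else .tau)
    (fun i => if i.1 < 2 * N then .nil else tBeep N) ⟨2 * N, by omega⟩
  have h1 : ¬ (2 * N < N) := by omega
  simp only [h1, if_false, lt_irrefl] at this
  exact this

theorem sum_step_inv {k : ℕ} {a : Fin (k+1) → Act} {c : Fin (k+1) → Tm} {α : Act}
    {ρ : FinDist Tm} (h : Step (.sum k a c) α ρ) : ∃ i, α = a i ∧ ρ = dirac (c i) := by
  cases h with
  | choice _ _ i => exact ⟨i, rfl, rfl⟩

theorem tObs_inp {N a : ℕ} (ha : a < N) : Step (tObs N) (.inp a) (dirac .nil) := by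
  have := Step.choice (k := 2 * N)
    (fun i => if i.1 < N then .inp i.1 else if i.1 < 2 * N then .out (i.1 - N) else .tau)
    (fun i => if i.1 < 2 * N then .nil else tBeep N) ⟨a, by omega⟩
  have h2 : a < 2 * N := by omega
  simp only [ha, h2, if_true] at this
  exact this

theorem tObs_out {N a : ℕ} (ha : a < N) : Step (tObs N) (.out a) (dirac .nil) := by
  have := Step.choice (k := 2 * N)
    (fun i => if i.1 < N then .inp i.1 else if i.1 < 2 * N then .out (i.1 - N) else .tau)
    (fun i => if i.1 < 2 * N then .nil else tBeep N) ⟨N + a, by omega⟩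
  have h1 : ¬ (N + a < N) := by omega
  have h2 : N + a < 2 * N := by omega
  have h3 : N + a - N = a := by omega
  simp only [h1, if_false, h2, if_true, h3] at this
  exact this

theorem tObs_label {N : ℕ} {α : Act} (h : α.IsLabel) (hc : α.chans ⊆ Finset.range N) :
    ∃ β, Act.Comp α β ∧ Step (tObs N) β (dirac .nil) := by
  cases α with
  | inp a =>
    exact ⟨.out a, ⟨a, Or.inl ⟨rfl, rfl⟩⟩, tObs_out (by simpa [Act.chans] using hc)⟩
  | out a =>
    exact ⟨.inp a, ⟨a, Or.inr ⟨rfl, rfl⟩⟩, tObs_inp (by simpa [Act.chans] using hc)⟩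
  | tau => exact h.elim
  | omega => exact h.elim

theorem tObs_tau_inv {N : ℕ} {ρ : FinDist Tm} (h : Step (tObs N) .tau ρ) :
    ρ = dirac (tBeep N) := by
  obtain ⟨i, hα, rfl⟩ := sum_step_inv h
  by_cases h1 : i.1 < 2 * N
  · exfalso
    by_cases h2 : i.1 < N
    · simp [h2] at hα
    · simp [h1, h2] at hα
  · simp [h1]

theorem label_not_allowed {α : Act} {L : Finset Chan} (h : α.IsLabel) (hc : α.chans ⊆ L) :
    ¬ Act.Allowed L α := by
  cases α with
  | inp a => intro h'; exact h' (hc (by simp [Act.chans]))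
  | out a => intro h'; exact h' (hc (by simp [Act.chans]))
  | tau => exact h.elim
  | omega => exact h.elim

theorem may_dead {L : Finset Chan} {P : Tm} (hP : P.chans ⊆ L) :
    may (.loc L (.par P .nil)) = 0 := by
  have key := may_least
    (f := fun X => if ∃ P : Tm, P.chans ⊆ L ∧ X = .loc L (.par P .nil) then 0 else 1)
    (fun X => by split_ifs <;> simp)
    (fun X hX => by
      split_ifs with h
      · exfalso
        obtain ⟨P, h1, rfl⟩ := h
        obtain ⟨α, ρ, h2, h3⟩ := hX
        cases h3 with
        | loc _ h3 hb =>
          cases h3 with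
          | parL _ h4 => exact label_not_allowed h2 (step_chans h4 h1).1 hb
          | parR _ h4 => cases h4
          | comm _ _ h4 => cases h4
      · exact le_rfl)
    (fun X ρ hs => by
      split_ifs with h
      · obtain ⟨P, h1, rfl⟩ := h
        refine ev_le _ fun Q hQ => ?_
        cases hs with
        | loc _ h3 hb =>
          cases h3 with
          | parL _ h4 =>
            obtain ⟨A, hA, rfl⟩ := locD_ne hQ
            obtain ⟨B, C, hB, hC, rfl⟩ := parD_ne hA
            rw [dirac_ne hC, if_pos ⟨B, (step_chans h4 h1).2 B hB, rfl⟩]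
          | parR _ h4 => cases h4
          | comm _ _ h4 => cases h4
      · exact ev_le _ fun Q _ => by split_ifs <;> simp)
    (.loc L (.par P .nil))
  rw [if_pos ⟨P, hP, rfl⟩] at key
  exact le_antisymm key (may_nonneg _)

theorem may_le_test {N : ℕ} {P : Tm} (hP : P.chans ⊆ Finset.range N) :
    may P ≤ 1 - fair (.loc (Finset.range N) (.par P (tObs N))) := by
  have key := may_least
    (f := fun X => if X.chans ⊆ Finset.range N then
      1 - fair (.loc (Finset.range N) (.par X (tObs N))) else 1)
    (fun X => by
      split_ifs
      · linarith [fair_le_one (.loc (Finset.range N) (.par X (tObs N)))]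
      · simp)
    (fun X hX => by
      split_ifs with h
      · obtain ⟨α, ρ, h2, h3⟩ := hX
        obtain ⟨β, hc, h4⟩ := tObs_label h2 (step_chans h3 h).1
        have h5 := fair_step (Step.loc (Finset.range N) (Step.comm hc h3 h4) trivial)
        rw [ev_locD, ev_parD] at h5
        simp only [ev_dirac] at h5
        have h6 : ρ.ev (fun a => fair (.loc (Finset.range N) (.par a .nil))) ≤ 0 :=
          ev_le _ fun Q hQ => by
            rw [← may_dead ((step_chans h3 h).2 Q hQ)]
            exact fair_le_may _
        linarith
      · exact le_rfl)
    (fun X ρ hs => by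
      split_ifs with h
      · have h5 := fair_step (Step.loc (Finset.range N) (Step.parL (tObs N) hs) trivial)
        rw [ev_locD, ev_parD] at h5
        simp only [ev_dirac] at h5
        rw [ev_congr ρ (g := fun X => 1 - fair (.loc (Finset.range N) (.par X (tObs N))))
          (fun Q hQ => if_pos ((step_chans hs h).2 Q hQ)), ev_one_sub]
        linarith
      · exact ev_le _ fun Q _ => by
          split_ifs
          · linarith [fair_nonneg (.loc (Finset.range N) (.par Q (tObs N)))]
          · exact le_rfl)
    P
  rwa [if_pos hP] at key

/-- Auxiliary submartingale used to bound the fair characteristic of the test. -/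
noncomputable def gTest (N : ℕ) : Tm → ℝ
  | .loc L (.par P R) =>
      if L = Finset.range N ∧ P.chans ⊆ Finset.range N then
        (if R = tObs N then 1 - may P else if R = tBeep N then 1 else 0)
      else 0
  | _ => 0

theorem gTest_nonneg (N : ℕ) (X : Tm) : 0 ≤ gTest N X := by
  unfold gTest
  split
  · split_ifs
    · exact sub_nonneg.2 (may_le_one _)
    · simp
    · simp
    · simp
  · simp

theorem gTest_obs {N : ℕ} {P : Tm} (hP : P.chans ⊆ Finset.range N) :
    gTest N (.loc (Finset.range N) (.par P (tObs N))) = 1 - may P := by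
  simp [gTest, hP]

theorem tBeep_ne {N : ℕ} (hN : 0 < N) : tBeep N ≠ tObs N := by
  intro h
  unfold tBeep tObs at h
  injection h with h
  omega

theorem gTest_beep {N : ℕ} (hN : 0 < N) {P : Tm} (hP : P.chans ⊆ Finset.range N) :
    gTest N (.loc (Finset.range N) (.par P (tBeep N))) = 1 := by
  simp [gTest, hP, tBeep_ne hN]

theorem gTest_cases (N : ℕ) (X : Tm) : gTest N X = 0 ∨
    (∃ P : Tm, P.chans ⊆ Finset.range N ∧ X = .loc (Finset.range N) (.par P (tObs N))) ∨
    (∃ P : Tm, P.chans ⊆ Finset.range N ∧ X = .loc (Finset.range N) (.par P (tBeep N))) := by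
  unfold gTest
  split
  · split_ifs with h1 h2 h3
    · exact Or.inr (Or.inl ⟨_, h1.2, by rw [h1.1, h2]⟩)
    · exact Or.inr (Or.inr ⟨_, h1.2, by rw [h1.1, h3]⟩)
    · exact Or.inl rfl
    · exact Or.inl rfl
  · exact Or.inl rfl

theorem beep_psi (N : ℕ) (P : Tm) : Tm.loc (Finset.range N) (.par P (tBeep N)) ∈ psiL :=
  ⟨.inp N, _, trivial, Step.loc _ (Step.parR P (Step.choice (fun _ => .inp N) (fun _ => .nil) 0))
    (by simp [Act.Allowed])⟩

theorem test_le_may {N : ℕ} (hN : 0 < N) {P : Tm} (hP : P.chans ⊆ Finset.range N) :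
    1 - may P ≤ fair (.loc (Finset.range N) (.par P (tObs N))) := by
  rw [← gTest_obs hP]
  apply fair_greatest
  · intro X
    rcases gTest_cases N X with h | ⟨P, h, rfl⟩ | ⟨P, h, rfl⟩
    · rw [h]; exact may_nonneg X
    · rw [gTest_obs h]
      have := may_step (Step.loc (Finset.range N) (Step.parR P (tObs_tau N)) trivial)
      rw [parD_dirac, locD_dirac, ev_dirac, may_psi (beep_psi N P)] at this
      linarith [may_nonneg P]
    · rw [gTest_beep hN h, may_psi (beep_psi N P)]
  · intro X ρ hs
    rcases gTest_cases N X with h | ⟨P, h, rfl⟩ | ⟨P, h, rfl⟩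
    · rw [h]; exact le_ev _ fun Q _ => gTest_nonneg N Q
    · rw [gTest_obs h]
      cases hs with
      | loc _ hs hb =>
        cases hs with
        | parL _ hs =>
          rw [ev_locD, ev_parD]
          simp only [ev_dirac]
          rw [ev_congr _ fun Q hQ => gTest_obs ((step_chans hs h).2 Q hQ), ev_one_sub]
          linarith [may_step hs]
        | parR _ hs =>
          rw [tObs_tau_inv hs, parD_dirac, locD_dirac, ev_dirac, gTest_beep hN h]
          linarith [may_nonneg P]
        | @comm _ _ l1 l2 _ _ hc hs1 hs2 =>
          have : P ∈ psiL := by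
            refine ⟨l1, _, ?_, hs1⟩
            obtain ⟨a, ⟨rfl, _⟩ | ⟨rfl, _⟩⟩ := hc <;> trivial
          rw [may_psi this, sub_self]
          exact le_ev _ fun Q _ => gTest_nonneg N Q
    · rw [gTest_beep hN h]
      cases hs with
      | loc _ hs hb =>
        cases hs with
        | parL _ hs =>
          rw [ev_locD, ev_parD]
          simp only [ev_dirac]
          exact le_ev _ fun Q hQ => (gTest_beep hN ((step_chans hs h).2 Q hQ)).ge
        | parR _ hs =>
          obtain ⟨i, hα, _⟩ := sum_step_inv hs
          simp at hα
        | @comm _ _ l1 l2 _ _ hc hs1 hs2 =>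
          exfalso
          unfold tBeep at hs2
          cases hs2 with
          | choice _ _ i =>
            obtain ⟨a, ⟨rfl, h2⟩ | ⟨rfl, h2⟩⟩ := hc
            · simp at h2
            · have h3 := (step_chans hs1 h).1
              simp only [Act.inp.injEq] at h2
              subst h2
              simp [Act.chans] at h3

theorem exists_bound (s : Finset Chan) : ∃ N : ℕ, s ⊆ Finset.range N := by
  refine ⟨s.sup id + 1, fun a ha => ?_⟩
  have := Finset.le_sup (f := id) ha
  simp only [id] at this
  rw [Finset.mem_range]
  exact Nat.lt_succ_of_le this

theorem may_of_fair {P Q : Tm} (h : CEq fair P Q) : CEq may P Q := by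
  intro C
  obtain ⟨N, hN⟩ := exists_bound ((fill C P).chans ∪ (fill C Q).chans)
  have hN' : ((fill C P).chans ∪ (fill C Q).chans) ⊆ Finset.range (N + 1) :=
    hN.trans (Finset.range_mono (by omega))
  have h1 := Finset.union_subset_left hN'
  have h2 := Finset.union_subset_right hN'
  have h3 := h.fill C [.inl ⟨tObs (N + 1), tObs_isProc _⟩, .inr (Finset.range (N + 1))]
  simp only [fill] at h3
  have e1 := may_le_test h1
  have e2 := may_le_test h2
  have e3 := test_le_may (Nat.succ_pos N) h1
  have e4 := test_le_may (Nat.succ_pos N) h2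
  linarith

/-! ## Congruence for the finite operators -/

/-- The two characteristics. -/
def IsChi (χ : Tm → ℝ) : Prop := χ = may ∨ χ = fair

theorem CEq.toMay {χ : Tm → ℝ} (hχ : IsChi χ) {P Q : Tm} (h : CEq χ P Q) : CEq may P Q := by
  rcases hχ with rfl | rfl
  · exact h
  · exact may_of_fair h

/-- Symmetric bisimulations up to contextual equality are sound. -/
theorem ceq_of_prog {χ : Tm → ℝ} (hχ : IsChi χ) {R : Tm → Tm → Prop}
    (hsym : ∀ X Y, R X Y → R Y X) (hm : Prog may R R) (h : Prog χ R R) {X Y : Tm}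
    (hXY : R X Y) : CEq χ X Y := by
  rcases hχ with rfl | rfl
  · exact ceq_may_of_prog hsym h hXY
  · exact ceq_fair_of_prog hsym (fun X Y h0 => ceq_may_of_prog hsym hm h0) h hXY

/-- The symmetric relation with a single pair. -/
def pairRel (A B : Tm) : Tm → Tm → Prop := fun X Y => (X = A ∧ Y = B) ∨ (X = B ∧ Y = A)

theorem pairRel_symm (A B X Y : Tm) (h : pairRel A B X Y) : pairRel A B Y X := by
  rcases h with ⟨rfl, rfl⟩ | ⟨rfl, rfl⟩
  · exact Or.inr ⟨rfl, rfl⟩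
  · exact Or.inl ⟨rfl, rfl⟩

theorem sum_prog {χ : Tm → ℝ} {k : ℕ} {acts : Fin (k+1) → Act} {P1 P2 : Fin (k+1) → Tm}
    (h : ∀ i, CEq χ (P1 i) (P2 i)) :
    Prog χ (pairRel (.sum k acts P1) (.sum k acts P2))
      (pairRel (.sum k acts P1) (.sum k acts P2)) := by
  rintro X Y (⟨rfl, rfl⟩ | ⟨rfl, rfl⟩) α ρ hs
  · cases hs with
    | choice _ _ i => exact ⟨_, Step.choice acts P2 i, DLift.dirac (Or.inr (h i))⟩
  · cases hs with
    | choice _ _ i => exact ⟨_, Step.choice acts P1 i, DLift.dirac (Or.inr (h i).symm)⟩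

theorem sum_ceq {χ : Tm → ℝ} (hχ : IsChi χ) {k : ℕ} {acts : Fin (k+1) → Act}
    {P1 P2 : Fin (k+1) → Tm} (h : ∀ i, CEq χ (P1 i) (P2 i)) :
    CEq χ (.sum k acts P1) (.sum k acts P2) :=
  ceq_of_prog hχ (pairRel_symm _ _) (sum_prog fun i => (h i).toMay hχ) (sum_prog h)
    (Or.inl ⟨rfl, rfl⟩)

/-- The distribution produced by a probabilistic choice. -/
theorem exists_oplus {k : ℕ} {w : Fin (k+1) → ℝ} (h0 : ∀ i, 0 < w i) (h1 : ∑ i, w i = 1)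
    (c : Fin (k+1) → Tm) :
    ∃ ρ : FinDist Tm, ∀ Q, ρ.toFun Q = ∑ i, if c i = Q then w i else 0 := by
  have hsub : Function.support (fun Q => ∑ i, if c i = Q then w i else 0) ⊆
      ((Finset.univ.image c : Finset Tm) : Set Tm) := by
    intro Q hQ
    obtain ⟨i, _, hi⟩ := Finset.exists_ne_zero_of_sum_ne_zero hQ
    have : c i = Q := by
      by_contra hn
      simp [hn] at hi
    simp only [Finset.coe_image, Set.mem_image, Finset.coe_univ]
    exact ⟨i, trivial, this⟩
  refine ⟨⟨fun Q => ∑ i, if c i = Q then w i else 0, fun Q => Finset.sum_nonneg fun i _ => ?_,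
    (Finset.finite_toSet _).subset hsub, ?_⟩, fun Q => rfl⟩
  · split_ifs
    · exact (h0 i).le
    · exact le_rfl
  · rw [finsum_eq_finsetSum_of_support_subset _ hsub, Finset.sum_comm, ← h1]
    refine Finset.sum_congr rfl fun i _ => ?_
    rw [Finset.sum_ite_eq, if_pos (Finset.mem_image_of_mem c (Finset.mem_univ i))]

theorem oplus_step {χ : Tm → ℝ} {k : ℕ} {w : Fin (k+1) → ℝ} {P1 P2 : Fin (k+1) → Tm}
    (R : Tm → Tm → Prop) (hw : ∀ i, 0 < w i ∧ w i < 1) (hw1 : ∑ i, w i = 1)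
    (h : ∀ i, CEq χ (P1 i) (P2 i)) {α : Act} {ρ : FinDist Tm}
    (hs : Step (.oplus k w P1) α ρ) :
    ∃ ρ', Step (.oplus k w P2) α ρ' ∧ DLift (fun x y => R x y ∨ CEq χ x y) ρ ρ' := by
  cases hs with
  | oplus _ _ _ h1 h2 =>
    obtain ⟨ρ', h3⟩ := exists_oplus (fun i => (hw i).1) hw1 P2
    refine ⟨ρ', Step.oplus w P2 ρ' hw h3, fun f g hfg => ?_⟩
    rw [oplus_ev h2, oplus_ev h3]
    exact Finset.sum_le_sum fun i _ =>
      mul_le_mul_of_nonneg_left (hfg _ _ (Or.inr (h i))) (hw i).1.le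

theorem oplus_ceq {χ : Tm → ℝ} (hχ : IsChi χ) {k : ℕ} {w : Fin (k+1) → ℝ}
    {P1 P2 : Fin (k+1) → Tm} (hw : ∀ i, 0 < w i ∧ w i < 1) (hw1 : ∑ i, w i = 1)
    (h : ∀ i, CEq χ (P1 i) (P2 i)) :
    CEq χ (.oplus k w P1) (.oplus k w P2) := by
  have hp : ∀ χ' : Tm → ℝ, (∀ i, CEq χ' (P1 i) (P2 i)) →
      Prog χ' (pairRel (.oplus k w P1) (.oplus k w P2))
        (pairRel (.oplus k w P1) (.oplus k w P2)) := by
    rintro χ' h X Y (⟨rfl, rfl⟩ | ⟨rfl, rfl⟩) α ρ hs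
    · exact oplus_step _ hw hw1 h hs
    · exact oplus_step _ hw hw1 (fun i => (h i).symm) hs
  exact ceq_of_prog hχ (pairRel_symm _ _) (hp may fun i => (h i).toMay hχ) (hp χ h)
    (Or.inl ⟨rfl, rfl⟩)

theorem comp_symm {a b : Act} (h : Act.Comp a b) : Act.Comp b a := by
  obtain ⟨c, ⟨h1, h2⟩ | ⟨h1, h2⟩⟩ := h
  · exact ⟨c, Or.inr ⟨h2, h1⟩⟩
  · exact ⟨c, Or.inl ⟨h2, h1⟩⟩

/-- Swapping the components of a parallel composition. -/
def swapRel : Tm → Tm → Prop := fun X Y => ∃ A B, X = .par A B ∧ Y = .par B A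

theorem dlift_swap {S : Tm → Tm → Prop} (hS : ∀ A B, S (.par A B) (.par B A))
    (ρ σ : FinDist Tm) : DLift S (ρ.parD σ) (σ.parD ρ) := by
  intro f g hfg
  rw [ev_parD, ev_parD, ev_swap]
  exact ev_mono _ fun a _ => ev_mono _ fun b _ => hfg _ _ (hS b a)

theorem swap_prog (χ : Tm → ℝ) : Prog χ swapRel swapRel := by
  rintro X Y ⟨A, B, rfl, rfl⟩ α ρ hs
  have hS : ∀ A B : Tm, swapRel (.par A B) (.par B A) ∨ CEq χ (.par A B) (.par B A) :=
    fun A B => Or.inl ⟨A, B, rfl, rfl⟩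
  cases hs with
  | parL _ hs => exact ⟨_, Step.parR B hs, dlift_swap hS _ _⟩
  | parR _ hs => exact ⟨_, Step.parL A hs, dlift_swap hS _ _⟩
  | comm hc h1 h2 => exact ⟨_, Step.comm (comp_symm hc) h2 h1, dlift_swap hS _ _⟩

theorem swap_ceq {χ : Tm → ℝ} (hχ : IsChi χ) (A B : Tm) : CEq χ (.par A B) (.par B A) :=
  ceq_of_prog hχ (R := swapRel) (by rintro X Y ⟨A, B, rfl, rfl⟩; exact ⟨B, A, rfl, rfl⟩)
    (swap_prog may) (swap_prog χ) ⟨A, B, rfl, rfl⟩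

theorem parLeft_ceq {χ : Tm → ℝ} (hχ : IsChi χ) {P Q R : Tm} (h : CEq χ P Q) (hR : R.IsProc) :
    CEq χ (.par R P) (.par R Q) :=
  ((swap_ceq hχ R P).trans (h.par hR)).trans (swap_ceq hχ Q R)

theorem unfold_prog (χ : Tm → ℝ) (T : Tm) :
    Prog χ (pairRel (.fix T) (Tm.subst (.fix T) 0 T))
      (pairRel (.fix T) (Tm.subst (.fix T) 0 T)) := by
  rintro X Y (⟨rfl, rfl⟩ | ⟨rfl, rfl⟩) α ρ hs
  · cases hs with
    | fixp hs => exact ⟨ρ, hs, DLift.refl _ fun x _ => Or.inr (CEq.refl χ x)⟩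
  · exact ⟨ρ, Step.fixp hs, DLift.refl _ fun x _ => Or.inr (CEq.refl χ x)⟩

theorem unfold_ceq {χ : Tm → ℝ} (hχ : IsChi χ) (T : Tm) :
    CEq χ (.fix T) (Tm.subst (.fix T) 0 T) :=
  ceq_of_prog hχ (pairRel_symm _ _) (unfold_prog may T) (unfold_prog χ T) (Or.inl ⟨rfl, rfl⟩)

/-! ## The fixpoint operator -/

/-- `K[V]` versus `K[U]` for an arbitrary term context `K`. -/
inductive Cng (V U : Tm) : Tm → Tm → Prop where
  | hole : Cng V U V U
  | nil : Cng V U .nil .nil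
  | var (m : ℕ) : Cng V U (.var m) (.var m)
  | sum (k : ℕ) (a : Fin (k+1) → Act) (c d : Fin (k+1) → Tm) :
      (∀ i, Cng V U (c i) (d i)) → Cng V U (.sum k a c) (.sum k a d)
  | oplus (k : ℕ) (w : Fin (k+1) → ℝ) (c d : Fin (k+1) → Tm) :
      (∀ i, Cng V U (c i) (d i)) → Cng V U (.oplus k w c) (.oplus k w d)
  | par {A B C D : Tm} : Cng V U A B → Cng V U C D → Cng V U (.par A C) (.par B D)
  | loc (L : Finset Chan) {A B : Tm} : Cng V U A B → Cng V U (.loc L A) (.loc L B)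
  | fix {A B : Tm} : Cng V U A B → Cng V U (.fix A) (.fix B)

theorem Cng.refl (V U T : Tm) : Cng V U T T := by
  induction T with
  | nil => exact .nil
  | var m => exact .var m
  | sum k a c ih => exact .sum k a c c ih
  | oplus k a c ih => exact .oplus k a c c ih
  | par S T ih1 ih2 => exact .par ih1 ih2
  | loc L T ih => exact .loc L ih
  | fix T ih => exact .fix ih

theorem Cng.subst {V U : Tm} (hV : V.ClosedAt 0) (hU : U.ClosedAt 0) {A B : Tm}
    (hAB : Cng V U A B) {X Y : Tm} (h : Cng V U X Y) :
    ∀ n, Cng V U (Tm.subst A n X) (Tm.subst B n Y) := by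
  induction h with
  | hole =>
    intro n
    rw [subst_closed A (Nat.zero_le n) hV, subst_closed B (Nat.zero_le n) hU]
    exact .hole
  | nil => intro n; exact .nil
  | var m =>
    intro n
    simp only [Tm.subst]
    split_ifs
    · exact hAB
    · exact .var m
  | sum k a c d _ ih => intro n; exact .sum _ _ _ _ fun i => ih i n
  | oplus k a c d _ ih => intro n; exact .oplus _ _ _ _ fun i => ih i n
  | par _ _ ih1 ih2 => intro n; exact .par (ih1 n) (ih2 n)
  | loc L _ ih => intro n; exact .loc L (ih n)
  | fix _ ih => intro n; exact .fix (ih (n + 1))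

theorem Cng.fill {V U X Y : Tm} (h : Cng V U X Y) (C : Frames) :
    Cng V U (_root_.fill C X) (_root_.fill C Y) := by
  induction C generalizing X Y with
  | nil => exact h
  | cons fr C ih =>
    cases fr with
    | inl T => exact ih (.par h (Cng.refl V U T.1))
    | inr L => exact ih (.loc L h)

/-- Steps of `K[fix T]` are matched, up to contextual equality, by `K[U]` if `U = T[U]`. -/
theorem cng_step {χ : Tm → ℝ} (hχ : IsChi χ) {T U : Tm} (hV : (Tm.fix T).IsProc)
    (hU : U.IsProc) (hTU : (Tm.subst U 0 T).IsProc) (hfix : CEq χ U (Tm.subst U 0 T))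
    {X : Tm} {α : Act} {ρ : FinDist Tm}
    (hs : Step X α ρ) : ∀ Y, Cng (.fix T) U X Y → Y.IsProc →
      ∃ Y' ρ', Y'.IsProc ∧ CEq χ Y Y' ∧ Step Y' α ρ' ∧
        DLift (fun x y => Cng (.fix T) U x y ∧ y.IsProc) ρ ρ' := by
  induction hs with
  | choice acts conts i =>
    intro Y hc hY
    cases hc with
    | sum _ _ _ d h =>
      exact ⟨_, _, hY, CEq.refl _ _, Step.choice acts d i,
        DLift.dirac ⟨h i, hY.1 i, hY.2.2 i⟩⟩
  | @oplus k w conts ρ h1 h2 =>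
    intro Y hc hY
    cases hc with
    | oplus _ _ _ d h =>
      have hw1 : ∑ i, w i = 1 := by
        have := oplus_ev h2 (fun _ => 1)
        rw [ev_const] at this
        simpa using this.symm
      obtain ⟨ρ', h3⟩ := exists_oplus (fun i => (h1 i).1) hw1 d
      refine ⟨_, ρ', hY, CEq.refl _ _, Step.oplus w d ρ' h1 h3, fun f g hfg => ?_⟩
      rw [oplus_ev h2, oplus_ev h3]
      exact Finset.sum_le_sum fun i _ =>
        mul_le_mul_of_nonneg_left (hfg _ _ ⟨h i, hY.1 i, hY.2 i⟩) (h1 i).1.le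
  | parL S hs ih =>
    intro Y hc hY
    cases hc with
    | @par _ B _ D hB hD =>
      have pB : B.IsProc := ⟨hY.1.1, hY.2.1⟩
      have pD : D.IsProc := ⟨hY.1.2, hY.2.2⟩
      obtain ⟨Y', ρ', h1, h2, h3, h4⟩ := ih B hB pB
      refine ⟨.par Y' D, _, ⟨⟨h1.1, pD.1⟩, ⟨h1.2, pD.2⟩⟩, h2.par pD, Step.parL D h3,
        h4.par (DLift.dirac (R := fun x y => Cng (.fix T) U x y ∧ y.IsProc) ⟨hD, pD⟩) ?_⟩
      rintro x y a b ⟨e1, e2⟩ ⟨e3, e4⟩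
      exact ⟨.par e1 e3, ⟨e2.1, e4.1⟩, ⟨e2.2, e4.2⟩⟩
  | parR S hs ih =>
    intro Y hc hY
    cases hc with
    | @par _ B _ D hB hD =>
      have pB : B.IsProc := ⟨hY.1.1, hY.2.1⟩
      have pD : D.IsProc := ⟨hY.1.2, hY.2.2⟩
      obtain ⟨Y', ρ', h1, h2, h3, h4⟩ := ih D hD pD
      refine ⟨.par B Y', _, ⟨⟨pB.1, h1.1⟩, ⟨pB.2, h1.2⟩⟩, parLeft_ceq hχ h2 pB, Step.parR B h3,
        (DLift.dirac (R := fun x y => Cng (.fix T) U x y ∧ y.IsProc) ⟨hB, pB⟩).par h4 ?_⟩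
      rintro x y a b ⟨e1, e2⟩ ⟨e3, e4⟩
      exact ⟨.par e1 e3, ⟨e2.1, e4.1⟩, ⟨e2.2, e4.2⟩⟩
  | comm hcomp _ _ ih1 ih2 =>
    intro Y hc hY
    cases hc with
    | @par _ B _ D hB hD =>
      have pB : B.IsProc := ⟨hY.1.1, hY.2.1⟩
      have pD : D.IsProc := ⟨hY.1.2, hY.2.2⟩
      obtain ⟨Y1, ρ1, h1, h2, h3, h4⟩ := ih1 B hB pB
      obtain ⟨Y2, ρ2, k1, k2, k3, k4⟩ := ih2 D hD pD
      refine ⟨.par Y1 Y2, _, ⟨⟨h1.1, k1.1⟩, ⟨h1.2, k1.2⟩⟩,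
        (h2.par pD).trans (parLeft_ceq hχ k2 h1), Step.comm hcomp h3 k3, h4.par k4 ?_⟩
      rintro x y a b ⟨e1, e2⟩ ⟨e3, e4⟩
      exact ⟨.par e1 e3, ⟨e2.1, e4.1⟩, ⟨e2.2, e4.2⟩⟩
  | loc L hs hb ih =>
    intro Y hc hY
    cases hc with
    | @loc _ _ B hB =>
      obtain ⟨Y', ρ', h1, h2, h3, h4⟩ := ih B hB hY
      exact ⟨.loc L Y', _, h1, h2.loc L, Step.loc L h3 hb,
        h4.loc L fun x y ⟨e1, e2⟩ => ⟨.loc L e1, e2⟩⟩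
  | @fixp A _ _ hs ih =>
    intro Y hc hY
    cases hc with
    | hole =>
      obtain ⟨Y', ρ', h1, h2, h3, h4⟩ := ih _
        (Cng.subst hV.1 hU.1 .hole (Cng.refl _ _ T) 0) hTU
      exact ⟨Y', ρ', h1, hfix.trans h2, h3, h4⟩
    | @fix _ B hB =>
      obtain ⟨Y', ρ', h1, h2, h3, h4⟩ := ih _
        (Cng.subst hV.1 hU.1 (.fix hB) hB 0) (isProc_unfold hY)
      exact ⟨Y', ρ', h1, (unfold_ceq hχ B).trans h2, h3, h4⟩

theorem cng_may {T U : Tm} (hV : (Tm.fix T).IsProc)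
    (hU : U.IsProc) (hTU : (Tm.subst U 0 T).IsProc) (hfix : CEq may U (Tm.subst U 0 T)) :
    ∀ X Y, Cng (.fix T) U X Y ∧ Y.IsProc → may X ≤ may Y := by
  apply may_sim
  · rintro X Y ⟨hc, hY⟩ ⟨α, ρ, h1, h2⟩
    obtain ⟨Y', ρ', _, h4, h5, _⟩ := cng_step (Or.inl rfl) hV hU hTU hfix h2 Y hc hY
    have e : may Y = may Y' := h4 []
    rw [e]
    exact may_psi ⟨α, ρ', h1, h5⟩
  · rintro X Y ⟨hc, hY⟩ ρ hs
    obtain ⟨Y', ρ', _, h4, h5, h6⟩ := cng_step (Or.inl rfl) hV hU hTU hfix hs Y hc hY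
    refine ⟨ρ', (may_step h5).trans (h4 []).ge, h6.mono fun x y h => Or.inl h⟩

theorem Cng.closedAt {V U : Tm} (hV : V.ClosedAt 0) {X Y : Tm} (h : Cng V U X Y) :
    ∀ n, Y.ClosedAt n → X.ClosedAt n := by
  induction h with
  | hole => intro n _; exact closedAt_mono (Nat.zero_le n) hV
  | nil => intro n h; exact h
  | var m => intro n h; exact h
  | sum k a c d _ ih => intro n h i; exact ih i n (h i)
  | oplus k a c d _ ih => intro n h i; exact ih i n (h i)
  | par _ _ ih1 ih2 => intro n h; exact ⟨ih1 n h.1, ih2 n h.2⟩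
  | loc L _ ih => intro n h; exact ih n h
  | fix _ ih => intro n h; exact ih (n + 1) h

theorem Cng.noOmega {V U : Tm} (hV : V.NoOmega) {X Y : Tm} (h : Cng V U X Y) :
    Y.NoOmega → X.NoOmega := by
  induction h with
  | hole => intro _; exact hV
  | nil => intro h; exact h
  | var m => intro h; exact h
  | sum k a c d _ ih => intro h; exact ⟨h.1, fun i => ih i (h.2 i)⟩
  | oplus k a c d _ ih => intro h i; exact ih i (h i)
  | par _ _ ih1 ih2 => intro h; exact ⟨ih1 h.1, ih2 h.2⟩
  | loc L _ ih => intro h; exact ih h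
  | fix _ ih => intro h; exact ih h

theorem Cng.isProc {V U : Tm} (hV : V.IsProc) {X Y : Tm} (h : Cng V U X Y) (hY : Y.IsProc) :
    X.IsProc := ⟨h.closedAt hV.1 0 hY.1, h.noOmega hV.2 hY.2⟩

theorem Cng.symm {V U X Y : Tm} (h : Cng V U X Y) : Cng U V Y X := by
  induction h with
  | hole => exact .hole
  | nil => exact .nil
  | var m => exact .var m
  | sum k a c d _ ih => exact .sum k a d c ih
  | oplus k a c d _ ih => exact .oplus k a d c ih
  | par _ _ ih1 ih2 => exact .par ih1 ih2
  | loc L _ ih => exact .loc L ih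
  | fix _ ih => exact .fix ih

theorem cng_fair {T U : Tm} (hV : (Tm.fix T).IsProc)
    (hU : U.IsProc) (hTU : (Tm.subst U 0 T).IsProc) (hfix : CEq fair U (Tm.subst U 0 T))
    (hm : ∀ X Y, Cng (.fix T) U X Y → X.IsProc → Y.IsProc → may Y ≤ may X) :
    ∀ Y X, Cng (.fix T) U X Y ∧ Y.IsProc → fair Y ≤ fair X := by
  apply fair_sim
  · rintro Y X ⟨hc, hY⟩
    exact hm X Y hc (hc.isProc hV hY) hY
  · rintro Y X ⟨hc, hY⟩ ρ hs
    obtain ⟨Y', ρ', _, h4, h5, h6⟩ := cng_step (Or.inr rfl) hV hU hTU hfix hs Y hc hY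
    exact ⟨ρ', (h4 []).le.trans (fair_step h5), h6.swap.mono (fun y x h => Or.inl h)⟩

/-! ## Simultaneous substitution -/

theorem msubst_closedAt {σ : ℕ → Tm} (hσ : ∀ m, (σ m).IsProc) (T : Tm) :
    ∀ d, (Tm.msubst σ d T).ClosedAt d := by
  induction T with
  | nil => intro d; trivial
  | var m =>
    intro d
    simp only [Tm.msubst]
    split_ifs with h
    · exact h
    · exact closedAt_mono (Nat.zero_le d) (hσ _).1
  | sum k a c ih => intro d i; exact ih i d
  | oplus k w c ih => intro d i; exact ih i d
  | par S T ih1 ih2 => intro d; exact ⟨ih1 d, ih2 d⟩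
  | loc L T ih => intro d; exact ih d
  | fix T ih => intro d; exact ih (d + 1)

theorem msubst_noOmega {σ : ℕ → Tm} (hσ : ∀ m, (σ m).IsProc) (T : Tm) :
    ∀ d, T.NoOmega → (Tm.msubst σ d T).NoOmega := by
  induction T with
  | nil => intro d _; trivial
  | var m =>
    intro d _
    simp only [Tm.msubst]
    split_ifs with h
    · trivial
    · exact (hσ _).2
  | sum k a c ih => intro d h; exact ⟨h.1, fun i => ih i d (h.2 i)⟩
  | oplus k w c ih => intro d h i; exact ih i d (h i)
  | par S T ih1 ih2 => intro d h; exact ⟨ih1 d h.1, ih2 d h.2⟩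
  | loc L T ih => intro d h; exact ih d h
  | fix T ih => intro d h; exact ih (d + 1) h

/-- Prepend a process to an assignment. -/
def consEnv (U : Tm) (σ : ℕ → Tm) : ℕ → Tm
  | 0 => U
  | m + 1 => σ m

theorem subst_msubst {σ : ℕ → Tm} (hσ : ∀ m, (σ m).IsProc) (U T : Tm) :
    ∀ d, Tm.subst U d (Tm.msubst σ (d + 1) T) = Tm.msubst (consEnv U σ) d T := by
  induction T with
  | nil => intro d; rfl
  | var m =>
    intro d
    simp only [Tm.msubst]
    rcases lt_trichotomy m d with h | h | h
    · rw [if_pos (by omega), if_pos h]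
      simp only [Tm.subst]
      rw [if_neg (by omega)]
    · subst h
      rw [if_pos (by omega), if_neg (by omega), Nat.sub_self]
      simp [Tm.subst, consEnv]
    · rw [if_neg (by omega), if_neg (by omega), subst_closed U (Nat.zero_le d) (hσ _).1]
      obtain ⟨j, rfl⟩ : ∃ j, m = d + 1 + j := ⟨m - (d + 1), by omega⟩
      have h1 : d + 1 + j - (d + 1) = j := by omega
      have h2 : d + 1 + j - d = j + 1 := by omega
      rw [h1, h2]
      rfl
  | sum k a c ih =>
    intro d
    simp only [Tm.msubst, Tm.subst, ih]
  | oplus k w c ih =>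
    intro d
    simp only [Tm.msubst, Tm.subst, ih]
  | par S T ih1 ih2 => intro d; simp only [Tm.msubst, Tm.subst, ih1, ih2]
  | loc L T ih => intro d; simp only [Tm.msubst, Tm.subst, ih]
  | fix T ih => intro d; simp only [Tm.msubst, Tm.subst, ih]

theorem fix_le_may {T U : Tm} (hV : (Tm.fix T).IsProc) (hU : U.IsProc)
    (hTU : (Tm.subst U 0 T).IsProc) (hfix : CEq may U (Tm.subst U 0 T)) (C : Frames) :
    may (fill C (.fix T)) ≤ may (fill C U) :=
  cng_may hV hU hTU hfix _ _ ⟨Cng.hole.fill C, fill_isProc C hU⟩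

theorem fix_ceq {χ : Tm → ℝ} (hχ : IsChi χ) {S T : Tm} (hS : S.NoOmega) (hT : T.NoOmega)
    (h : ∀ σ : ℕ → Tm, (∀ m, (σ m).IsProc) → CEq χ (Tm.msubst σ 0 S) (Tm.msubst σ 0 T))
    {σ : ℕ → Tm} (hσ : ∀ m, (σ m).IsProc) :
    CEq χ (Tm.msubst σ 0 (.fix S)) (Tm.msubst σ 0 (.fix T)) := by
  show CEq χ (.fix (Tm.msubst σ 1 S)) (.fix (Tm.msubst σ 1 T))
  have pU : (Tm.fix (Tm.msubst σ 1 S)).IsProc :=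
    ⟨msubst_closedAt hσ S 1, msubst_noOmega hσ S 1 hS⟩
  have pV : (Tm.fix (Tm.msubst σ 1 T)).IsProc :=
    ⟨msubst_closedAt hσ T 1, msubst_noOmega hσ T 1 hT⟩
  have hc : ∀ U : Tm, U.IsProc → ∀ m, (consEnv U σ m).IsProc := by
    intro U hU m
    cases m with
    | zero => exact hU
    | succ m => exact hσ m
  have eq1 : CEq χ (.fix (Tm.msubst σ 1 S))
      (Tm.subst (.fix (Tm.msubst σ 1 S)) 0 (Tm.msubst σ 1 T)) := by
    refine (unfold_ceq hχ _).trans ?_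
    rw [subst_msubst hσ, subst_msubst hσ]
    exact h _ (hc _ pU)
  have eq2 : CEq χ (.fix (Tm.msubst σ 1 T))
      (Tm.subst (.fix (Tm.msubst σ 1 T)) 0 (Tm.msubst σ 1 S)) := by
    refine (unfold_ceq hχ _).trans ?_
    rw [subst_msubst hσ, subst_msubst hσ]
    exact (h _ (hc _ pV)).symm
  have p1 : (Tm.subst (.fix (Tm.msubst σ 1 S)) 0 (Tm.msubst σ 1 T)).IsProc := by
    rw [subst_msubst hσ]
    exact ⟨msubst_closedAt (hc _ pU) T 0, msubst_noOmega (hc _ pU) T 0 hT⟩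
  have p2 : (Tm.subst (.fix (Tm.msubst σ 1 T)) 0 (Tm.msubst σ 1 S)).IsProc := by
    rw [subst_msubst hσ]
    exact ⟨msubst_closedAt (hc _ pV) S 0, msubst_noOmega (hc _ pV) S 0 hS⟩
  rcases hχ with rfl | rfl
  · intro C
    exact le_antisymm (fix_le_may pU pV p2 eq2 C) (fix_le_may pV pU p1 eq1 C)
  · have m1 := cng_may pV pU p1 (may_of_fair eq1)
    have m2 := cng_may pU pV p2 (may_of_fair eq2)
    have f1 := cng_fair pV pU p1 eq1 fun X Y hxy hX _ => m2 Y X ⟨hxy.symm, hX⟩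
    have f2 := cng_fair pU pV p2 eq2 fun X Y hxy hX _ => m1 Y X ⟨hxy.symm, hX⟩
    intro C
    exact le_antisymm (f1 _ _ ⟨Cng.hole.fill C, fill_isProc C pU⟩)
      (f2 _ _ ⟨Cng.hole.fill C, fill_isProc C pV⟩)

/-! ## Convex combinations -/

/-- Closure of a relation under linear combinations. -/
def LinRel (R : FinDist Tm → FinDist Tm → Prop) (μ1 μ2 : FinDist Tm) : Prop :=
  ∃ (n : ℕ) (p : Fin n → ℝ) (μ1s μ2s : Fin n → FinDist Tm),
    (∀ Q, μ1.toFun Q = ∑ i, p i * (μ1s i).toFun Q) ∧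
    (∀ Q, μ2.toFun Q = ∑ i, p i * (μ2s i).toFun Q) ∧ ∀ i, R (μ1s i) (μ2s i)

theorem lin_par {n : ℕ} {p : Fin n → ℝ} {μs : Fin n → FinDist Tm} {μ : FinDist Tm}
    (h : ∀ Q, μ.toFun Q = ∑ i, p i * (μs i).toFun Q) (ν : FinDist Tm) :
    ∀ Q, (μ.parD ν).toFun Q = ∑ i, p i * ((μs i).parD ν).toFun Q := by
  apply lin_of_ev
  intro f
  simp only [ev_parD]
  exact ev_lin p μs μ h _

theorem lin_loc {n : ℕ} {p : Fin n → ℝ} {μs : Fin n → FinDist Tm} {μ : FinDist Tm}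
    (h : ∀ Q, μ.toFun Q = ∑ i, p i * (μs i).toFun Q) (L : Finset Chan) :
    ∀ Q, (locD L μ).toFun Q = ∑ i, p i * (locD L (μs i)).toFun Q := by
  apply lin_of_ev
  intro f
  simp only [ev_locD]
  exact ev_lin p μs μ h _

theorem LinRel.ext {D : Set (FinDist Tm)} {R : FinDist Tm → FinDist Tm → Prop}
    (hR : DExtensional D R) : DExtensional D (LinRel R) := by
  rintro μ1 μ2 ⟨n, p, μ1s, μ2s, h1, h2, h3⟩
  exact ⟨fun ν hν => ⟨n, p, _, _, lin_par h1 ν, lin_par h2 ν, fun i => (hR _ _ (h3 i)).1 ν hν⟩,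
    fun L => ⟨n, p, _, _, lin_loc h1 L, lin_loc h2 L, fun i => (hR _ _ (h3 i)).2 L⟩⟩

theorem LinRel.eq {χ : Tm → ℝ} {χD : FinDist Tm → ℝ} (hχ : ∀ μ, χD μ = μ.ev χ)
    {R : FinDist Tm → FinDist Tm → Prop} (hR : ∀ μ1 μ2, R μ1 μ2 → χD μ1 = χD μ2)
    {μ1 μ2 : FinDist Tm} (h : LinRel R μ1 μ2) : χD μ1 = χD μ2 := by
  obtain ⟨n, p, μ1s, μ2s, h1, h2, h3⟩ := h
  rw [hχ, hχ, ev_lin p μ1s μ1 h1, ev_lin p μ2s μ2 h2]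
  refine Finset.sum_congr rfl fun i _ => ?_
  rw [← hχ, ← hχ, hR _ _ (h3 i)]

theorem diamond_ext (D : Set (FinDist Tm)) : DExtensional D (DiamondEq D) := by
  rintro μ1 μ2 ⟨R, h1, h2, h3⟩
  exact ⟨fun ν hν => ⟨R, h1, h2, (h2 _ _ h3).1 ν hν⟩, fun L => ⟨R, h1, h2, (h2 _ _ h3).2 L⟩⟩

theorem box_ext (D : Set (FinDist Tm)) : DExtensional D (BoxEq D) := by
  rintro μ1 μ2 ⟨R, h1, h2, h3⟩
  exact ⟨fun ν hν => ⟨R, h1, h2, (h2 _ _ h3).1 ν hν⟩, fun L => ⟨R, h1, h2, (h2 _ _ h3).2 L⟩⟩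

theorem diamond_lin {D : Set (FinDist Tm)} {μ1 μ2 : FinDist Tm}
    (h : LinRel (DiamondEq D) μ1 μ2) : DiamondEq D μ1 μ2 :=
  ⟨_, fun _ _ => LinRel.eq chiMay_eq fun _ _ ⟨_, h1, _, h3⟩ => h1 _ _ h3,
    LinRel.ext (diamond_ext D), h⟩

theorem box_lin {D : Set (FinDist Tm)} {μ1 μ2 : FinDist Tm}
    (h : LinRel (BoxEq D) μ1 μ2) : BoxEq D μ1 μ2 :=
  ⟨_, fun _ _ => LinRel.eq chiFair_eq fun _ _ ⟨_, h1, _, h3⟩ => h1 _ _ h3,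
    LinRel.ext (box_ext D), h⟩

/-- The congruence clauses for contextual equality. -/
theorem congruence_of {χ : Tm → ℝ} (hχ : IsChi χ) {eqv : Tm → Tm → Prop}
    (he : ∀ P Q, eqv P Q ↔ CEq χ P Q) :
      (∀ (k : ℕ) (acts : Fin (k+1) → Act) (P1 P2 : Fin (k+1) → Tm),
        (∀ i, acts i ≠ Act.omega) →
        (∀ i, (P1 i).IsProc) → (∀ i, (P2 i).IsProc) →
        (∀ i, eqv (P1 i) (P2 i)) → eqv (.sum k acts P1) (.sum k acts P2)) ∧
      (∀ (k : ℕ) (w : Fin (k+1) → ℝ) (P1 P2 : Fin (k+1) → Tm),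
        (∀ i, 0 < w i ∧ w i < 1) → (∑ i, w i = 1) →
        (∀ i, (P1 i).IsProc) → (∀ i, (P2 i).IsProc) →
        (∀ i, eqv (P1 i) (P2 i)) → eqv (.oplus k w P1) (.oplus k w P2)) ∧
      (∀ P Q R : Tm, P.IsProc → Q.IsProc → R.IsProc → eqv P Q →
        eqv (.par P R) (.par Q R) ∧ eqv (.par R P) (.par R Q)) ∧
      (∀ (P Q : Tm) (L : Finset Chan), P.IsProc → Q.IsProc → eqv P Q →
        eqv (.loc L P) (.loc L Q)) ∧
      (∀ S T : Tm, S.NoOmega → T.NoOmega →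
        (∀ σ : ℕ → Tm, (∀ m, (σ m).IsProc) →
          eqv (Tm.msubst σ 0 S) (Tm.msubst σ 0 T)) →
        ∀ σ : ℕ → Tm, (∀ m, (σ m).IsProc) →
          eqv (Tm.msubst σ 0 (.fix S)) (Tm.msubst σ 0 (.fix T))) := by
  simp only [he]
  exact ⟨fun k acts P1 P2 _ _ _ h => sum_ceq hχ h,
    fun k w P1 P2 hw hw1 _ _ h => oplus_ceq hχ hw hw1 h,
    fun P Q R _ _ hR h => ⟨h.par hR, parLeft_ceq hχ h hR⟩,
    fun P Q L _ _ h => h.loc L,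
    fun S T hS hT h σ hσ => fix_ceq hχ hS hT h hσ⟩

/-- congruence properties of the testing equivalences.
(1) For every testing context `𝒟`, the equivalences `=◇^𝒟` and `=□^𝒟` are
preserved by parallel composition with members of `𝒟`, by localization, and by
convex combinations.
(2) For `𝒟 = D(P_RCCS)`, the induced relations on processes (`=◇^p`, `=□^p` via
Dirac distributions) are congruences: preserved by nondeterministic choice,
probabilistic choice, parallel composition, localization and the fixpoint
operator. -/
theorem testing_equivalences_congruent :
    (∀ D : Set (FinDist Tm), IsTestingContext D →
      (∀ μ1 μ2 : FinDist Tm, DiamondEq D μ1 μ2 →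
        (∀ ν ∈ D, DiamondEq D (μ1.parD ν) (μ2.parD ν)) ∧
        (∀ L : Finset Chan, DiamondEq D (FinDist.locD L μ1) (FinDist.locD L μ2))) ∧
      (∀ μ1 μ2 : FinDist Tm, BoxEq D μ1 μ2 →
        (∀ ν ∈ D, BoxEq D (μ1.parD ν) (μ2.parD ν)) ∧
        (∀ L : Finset Chan, BoxEq D (FinDist.locD L μ1) (FinDist.locD L μ2))) ∧
      (∀ (n : ℕ) (p : Fin n → ℝ), (∀ i, 0 ≤ p i) → (∀ i, p i ≤ 1) →
        (∑ i, p i = 1) →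
        ∀ (μ1s μ2s : Fin n → FinDist Tm) (μ1 μ2 : FinDist Tm),
          (∀ Q, μ1.toFun Q = ∑ i, p i * (μ1s i).toFun Q) →
          (∀ Q, μ2.toFun Q = ∑ i, p i * (μ2s i).toFun Q) →
          ((∀ i, DiamondEq D (μ1s i) (μ2s i)) → DiamondEq D μ1 μ2) ∧
          ((∀ i, BoxEq D (μ1s i) (μ2s i)) → BoxEq D μ1 μ2))) ∧
    (∀ eqv : Tm → Tm → Prop,
      ((eqv = fun P Q => DiamondEq fullCtx (FinDist.dirac P) (FinDist.dirac Q)) ∨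
       (eqv = fun P Q => BoxEq fullCtx (FinDist.dirac P) (FinDist.dirac Q))) →
      (∀ (k : ℕ) (acts : Fin (k+1) → Act) (P1 P2 : Fin (k+1) → Tm),
        (∀ i, acts i ≠ Act.omega) →
        (∀ i, (P1 i).IsProc) → (∀ i, (P2 i).IsProc) →
        (∀ i, eqv (P1 i) (P2 i)) → eqv (.sum k acts P1) (.sum k acts P2)) ∧
      (∀ (k : ℕ) (w : Fin (k+1) → ℝ) (P1 P2 : Fin (k+1) → Tm),
        (∀ i, 0 < w i ∧ w i < 1) → (∑ i, w i = 1) →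
        (∀ i, (P1 i).IsProc) → (∀ i, (P2 i).IsProc) →
        (∀ i, eqv (P1 i) (P2 i)) → eqv (.oplus k w P1) (.oplus k w P2)) ∧
      (∀ P Q R : Tm, P.IsProc → Q.IsProc → R.IsProc → eqv P Q →
        eqv (.par P R) (.par Q R) ∧ eqv (.par R P) (.par R Q)) ∧
      (∀ (P Q : Tm) (L : Finset Chan), P.IsProc → Q.IsProc → eqv P Q →
        eqv (.loc L P) (.loc L Q)) ∧
      (∀ S T : Tm, S.NoOmega → T.NoOmega →
        (∀ σ : ℕ → Tm, (∀ m, (σ m).IsProc) →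
          eqv (Tm.msubst σ 0 S) (Tm.msubst σ 0 T)) →
        ∀ σ : ℕ → Tm, (∀ m, (σ m).IsProc) →
          eqv (Tm.msubst σ 0 (.fix S)) (Tm.msubst σ 0 (.fix T)))) := by
  refine ⟨fun D _ => ⟨fun μ1 μ2 h => diamond_ext D μ1 μ2 h, fun μ1 μ2 h => box_ext D μ1 μ2 h,
    fun n p _ _ _ μ1s μ2s μ1 μ2 h1 h2 =>
      ⟨fun h => diamond_lin ⟨n, p, μ1s, μ2s, h1, h2, h⟩,
        fun h => box_lin ⟨n, p, μ1s, μ2s, h1, h2, h⟩⟩⟩, ?_⟩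
  rintro eqv (rfl | rfl)
  · exact congruence_of (Or.inl rfl) diamond_iff
  · exact congruence_of (Or.inr rfl) box_iff
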